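/- arXiv:2012.10070 — 2 statements merged into one kernel-verified Lean document; each statement's English description precedes it below -/
import Mathlib

section
/- Let G be a b-monotone cactus graph with Grundy number k = Γ(G). Then b(G) ≥ k − 2⌊log₂ k⌋. -/
open SimpleGraph

/-- A proper coloring by natural number colors. -/
def IsProperNat {V : Type*} (G : SimpleGraph V) (c : V → ℕ) : Prop :=
  ∀ ⦃v w⦄, G.Adj v w → c v ≠ c w

/-- A Grundy coloring of `G` with colors `1, …, k`: proper, every color used, and
every vertex of color `j` has a neighbor of each color `i < j`. -/
def IsGrundyColoring {V : Type*} (G : SimpleGraph V) (k : ℕ) (c : V → ℕ) : Prop :=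
  (∀ v, c v ∈ Finset.Icc 1 k) ∧ IsProperNat G c ∧
  (∀ i ∈ Finset.Icc 1 k, ∃ v, c v = i) ∧
  (∀ v, ∀ i, 1 ≤ i → i < c v → ∃ w, G.Adj v w ∧ c w = i)

/-- The Grundy number: the maximum number of colors in a Grundy coloring. -/
noncomputable def grundyNumber {V : Type*} (G : SimpleGraph V) : ℕ :=
  sSup {k | ∃ c : V → ℕ, IsGrundyColoring G k c}

/-- A color-dominating (b-)coloring with colors `1, …, k`: proper, and each color class
contains a vertex having neighbors in all the other color classes. -/
def IsBColoring {V : Type*} (G : SimpleGraph V) (k : ℕ) (c : V → ℕ) : Prop :=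
  (∀ v, c v ∈ Finset.Icc 1 k) ∧ IsProperNat G c ∧
  (∀ i ∈ Finset.Icc 1 k, ∃ v, c v = i ∧
    ∀ j ∈ Finset.Icc 1 k, j ≠ i → ∃ w, G.Adj v w ∧ c w = j)

/-- The b-chromatic number: the maximum number of colors in a b-coloring. -/
noncomputable def bChromatic {V : Type*} (G : SimpleGraph V) : ℕ :=
  sSup {k | ∃ c : V → ℕ, IsBColoring G k c}

/-- `m(G) = max {k : d_k ≥ k - 1}` for the non-increasing degree sequence; equivalently
the largest `k` such that `G` has `k` vertices of degree at least `k - 1`. -/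
noncomputable def mParam {V : Type*} (G : SimpleGraph V) : ℕ :=
  sSup {k | ∃ s : Finset V, s.card = k ∧ ∀ v ∈ s, k - 1 ≤ (G.neighborSet v).ncard}

/-- A graph is b-monotone if the b-chromatic number of every induced subgraph is at most
that of the graph itself. -/
def BMonotone {V : Type*} (G : SimpleGraph V) : Prop :=
  ∀ s : Set V, bChromatic (G.induce s) ≤ bChromatic G

/-- A cactus graph: any two cycles share at most one vertex, i.e. two cycles sharing
two distinct vertices have the same edge set. -/
def IsCactus {V : Type*} (G : SimpleGraph V) : Prop :=
  ∀ (u v : V) (c₁ : G.Walk u u) (c₂ : G.Walk v v), c₁.IsCycle → c₂.IsCycle →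
    ∀ x y, x ≠ y → x ∈ c₁.support → y ∈ c₁.support → x ∈ c₂.support → y ∈ c₂.support →
      ∀ e, e ∈ c₁.edges ↔ e ∈ c₂.edges

/-- Two edges between disjoint connected sets lie on a common cycle, which uses no other edge
between the two sets. -/
lemma exists_isCycle_of_two_edges {V : Type*} {G : SimpleGraph V} {A D : Set V}
    (hA : (G.induce A).Preconnected) (hD : (G.induce D).Preconnected) (hAD : Disjoint A D)
    {a₁ a₂ d₁ d₂ : V} (ha₁ : a₁ ∈ A) (ha₂ : a₂ ∈ A) (hd₁ : d₁ ∈ D) (hd₂ : d₂ ∈ D)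
    (h₁ : G.Adj a₁ d₁) (h₂ : G.Adj a₂ d₂) (hne : a₁ ≠ a₂ ∨ d₁ ≠ d₂) :
    ∃ (u : V) (c : G.Walk u u), c.IsCycle ∧ a₁ ∈ c.support ∧ d₁ ∈ c.support ∧
      s(a₁, d₁) ∈ c.edges ∧ s(a₂, d₂) ∈ c.edges ∧
      ∀ a ∈ A, ∀ d ∈ D, s(a, d) ∈ c.edges → (a = a₁ ∧ d = d₁) ∨ (a = a₂ ∧ d = d₂) := by
  have key : ∀ {S : Set V}, (G.induce S).Preconnected → ∀ x ∈ S, ∀ y ∈ S,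
      ∃ p : G.Walk x y, p.IsPath ∧ ∀ z ∈ p.support, z ∈ S := by
    intro S hS x hx y hy
    obtain ⟨p, hp⟩ := (hS ⟨x, hx⟩ ⟨y, hy⟩).exists_isPath
    let f := (Embedding.induce (G := G) S).toHom
    have hsupp : ∀ z ∈ (p.map f).support, z ∈ S := by
      intro z hz
      rw [Walk.support_map, List.mem_map] at hz
      obtain ⟨w, -, rfl⟩ := hz
      exact w.2
    exact ⟨p.map f, hp.map Subtype.val_injective, hsupp⟩
  obtain ⟨p, hp, hpA⟩ := key hA a₂ ha₂ a₁ ha₁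
  obtain ⟨q, hq, hqD⟩ := key hD d₁ hd₁ d₂ hd₂
  have hdis : ∀ z, z ∈ A → z ∈ D → False := fun z h h' => Set.disjoint_left.mp hAD h h'
  have hpe : ∀ a d, d ∈ D → s(a, d) ∉ p.edges := fun a d hd h =>
    hdis d (hpA d (p.snd_mem_support_of_mem_edges h)) hd
  have hqe : ∀ a d, a ∈ A → s(a, d) ∉ q.edges := fun a d ha h =>
    hdis a ha (hqD a (q.fst_mem_support_of_mem_edges h))
  refine ⟨a₁, Walk.cons h₁ (q.append (Walk.cons h₂.symm p)), ?_, by simp, by simp, by simp,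
    by simp [Sym2.eq_swap], ?_⟩
  · rw [Walk.cons_isCycle_iff]
    constructor
    · rw [Walk.isPath_def, Walk.support_append, Walk.support_cons, List.tail_cons,
        List.nodup_append]
      refine ⟨hq.support_nodup, hp.support_nodup, ?_⟩
      rintro x hx y hy rfl
      exact hdis x (hpA x hy) (hqD x hx)
    · simp only [Walk.edges_append, Walk.edges_cons, List.mem_append, List.mem_cons, not_or]
      refine ⟨hqe _ _ ha₁, ?_, hpe _ _ hd₁⟩
      rw [Sym2.eq_iff]
      rintro (⟨h, -⟩ | ⟨h, h'⟩)
      · exact hdis a₁ ha₁ (h ▸ hd₂)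
      · rcases hne with h3 | h3
        · exact h3 h
        · exact h3 h'
  · intro a ha d hd h
    simp only [Walk.edges_append, Walk.edges_cons, List.mem_append, List.mem_cons] at h
    rcases h with h | h | h | h
    · rw [Sym2.eq_iff] at h
      rcases h with h | ⟨h, -⟩
      · exact Or.inl h
      · exact (hdis d₁ (h ▸ ha) hd₁).elim
    · exact (hqe _ _ ha h).elim
    · rw [Sym2.eq_iff] at h
      rcases h with ⟨h, -⟩ | h
      · exact (hdis d₂ (h ▸ ha) hd₂).elim
      · exact Or.inr h
    · exact (hpe _ _ hd h).elim

/-- In a cactus there are at most two edges between two disjoint connected sets. -/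
lemma IsCactus.not_three_edges {V : Type*} {G : SimpleGraph V} (hc : IsCactus G) {A D : Set V}
    (hA : (G.induce A).Preconnected) (hD : (G.induce D).Preconnected) (hAD : Disjoint A D)
    {a₁ a₂ a₃ d₁ d₂ d₃ : V} (ha₁ : a₁ ∈ A) (ha₂ : a₂ ∈ A) (ha₃ : a₃ ∈ A)
    (hd₁ : d₁ ∈ D) (hd₂ : d₂ ∈ D) (hd₃ : d₃ ∈ D)
    (h₁ : G.Adj a₁ d₁) (h₂ : G.Adj a₂ d₂) (h₃ : G.Adj a₃ d₃)
    (h₁₂ : a₁ ≠ a₂ ∨ d₁ ≠ d₂) (h₁₃ : a₁ ≠ a₃ ∨ d₁ ≠ d₃) (h₂₃ : a₂ ≠ a₃ ∨ d₂ ≠ d₃) : False := by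
  obtain ⟨u, c, hcy, hac, hdc, -, -, hcAD⟩ :=
    exists_isCycle_of_two_edges hA hD hAD ha₁ ha₂ hd₁ hd₂ h₁ h₂ h₁₂
  obtain ⟨v, c', hcy', hac', hdc', -, he, -⟩ :=
    exists_isCycle_of_two_edges hA hD hAD ha₁ ha₃ hd₁ hd₃ h₁ h₃ h₁₃
  have := hcAD a₃ ha₃ d₃ hd₃
    ((hc u v c c' hcy hcy' a₁ d₁ h₁.ne hac hdc hac' hdc' _).mpr he)
  grind

lemma IsCactus.induce {V : Type*} {G : SimpleGraph V} (hc : IsCactus G) (s : Set V) :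
    IsCactus (G.induce s) := by
  intro u v c₁ c₂ h₁ h₂ x y hxy hx₁ hy₁ hx₂ hy₂ e
  let f := (Embedding.induce (G := G) s).toHom
  have hf : Function.Injective f := Subtype.val_injective
  have hs : ∀ {u} (c : (G.induce s).Walk u u) x, x ∈ c.support → f x ∈ (c.map f).support := by
    intro u c x hx
    rw [Walk.support_map]
    exact List.mem_map_of_mem hx
  have := hc _ _ (c₁.map f) (c₂.map f) ((Walk.isCycle_map_iff_of_injective hf).2 h₁)
    ((Walk.isCycle_map_iff_of_injective hf).2 h₂) (f x) (f y) (hf.ne hxy)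
    (hs _ _ hx₁) (hs _ _ hy₁) (hs _ _ hx₂) (hs _ _ hy₂) (e.map f)
  simpa only [Walk.edges_map, List.mem_map_of_injective (Sym2.map.injective hf)] using this

open Classical in
lemma exists_fundamental_cycle {W : Type*} [Fintype W] {G T : SimpleGraph W} (hTG : T ≤ G)
    (hT : T.IsTree) {e : Sym2 W} (he : e ∈ G.edgeSet) (heT : e ∉ T.edgeSet) :
    ∃ S : Finset (Sym2 W), S ⊆ T.edgeFinset ∧ 2 ≤ S.card ∧
      ∃ (u : W) (c : G.Walk u u), c.IsCycle ∧ ∀ f, f ∈ c.edges ↔ f = e ∨ f ∈ S := by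
  induction e with | _ v w => ?_
  rw [mem_edgeSet] at he heT
  obtain ⟨p, hp⟩ := (hT.connected w v).exists_isPath
  refine ⟨p.edges.toFinset, ?_, ?_, v, Walk.cons he (p.mapLe hTG), ?_, by simp⟩
  · intro f hf
    simpa using p.edges_subset_edgeSet (List.mem_toFinset.1 hf)
  · rw [List.toFinset_card_of_nodup hp.isTrail.edges_nodup, Walk.length_edges]
    by_contra! hlt
    match p, hlt with
    | .nil, _ => exact he.ne rfl
    | .cons h .nil, _ => exact heT h.symm
    | .cons _ (.cons _ _), hlt => simp at hlt
  · rw [Walk.cons_isCycle_iff]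
    refine ⟨hp.mapLe hTG, ?_⟩
    rw [Walk.edges_mapLe_eq_edges]
    exact fun h => heT (p.adj_of_mem_edges h)

open Classical in
/-- A connected cactus on `n` vertices has at most `3 (n - 1) / 2` edges. -/
lemma IsCactus.two_mul_card_edgeFinset_le {W : Type*} [Fintype W] {G : SimpleGraph W}
    (hc : IsCactus G) (hG : G.Connected) :
    2 * G.edgeFinset.card + 3 ≤ 3 * Fintype.card W := by
  obtain ⟨T, hTG, hT⟩ := hG.exists_isTree_le
  have hcard := hT.card_edgeFinset
  let N := G.edgeFinset \ T.edgeFinset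
  have hN : ∀ e ∈ N, e ∈ G.edgeSet ∧ e ∉ T.edgeSet := by
    intro e he
    simpa [N] using he
  choose! S hST hS2 hcyc using fun e (he : e ∈ N) =>
    exists_fundamental_cycle hTG hT (hN e he).1 (hN e he).2
  have hdisj : (N : Set (Sym2 W)).PairwiseDisjoint S := by
    intro e he f hf hef
    rw [Function.onFun, Finset.disjoint_left]
    intro b hbe hbf
    have hbT := hST e he hbe
    induction b with | _ x y => ?_
    have hxy : T.Adj x y := by simpa using hbT
    obtain ⟨u, c, hcy, hcS⟩ := hcyc e he
    obtain ⟨u', c', hcy', hcS'⟩ := hcyc f hf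
    have h1 : s(x, y) ∈ c.edges := (hcS _).2 (Or.inr hbe)
    have h2 : s(x, y) ∈ c'.edges := (hcS' _).2 (Or.inr hbf)
    have := (hc _ _ _ _ hcy hcy' x y hxy.ne
      (Walk.fst_mem_support_of_mem_edges _ h1) (Walk.snd_mem_support_of_mem_edges _ h1)
      (Walk.fst_mem_support_of_mem_edges _ h2) (Walk.snd_mem_support_of_mem_edges _ h2) e).1
      ((hcS _).2 (Or.inl rfl))
    rcases (hcS' _).1 this with h | h
    · exact hef h
    · exact (hN e he).2 (by simpa using hST f hf h)
  have h1 : 2 * N.card ≤ (N.biUnion S).card := by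
    rw [Finset.card_biUnion hdisj, mul_comm]
    exact Finset.card_nsmul_le_sum _ _ _ hS2
  have h2 : (N.biUnion S).card ≤ T.edgeFinset.card :=
    Finset.card_le_card (Finset.biUnion_subset.2 hST)
  have h3 : N.card + T.edgeFinset.card = G.edgeFinset.card :=
    Finset.card_sdiff_add_card_eq_card (edgeFinset_mono hTG)
  omega

/-- Two distinct vertices are joined by a path with one or two inner vertices, all outside `X`. -/
def IsEar {V : Type*} (G : SimpleGraph V) (X : Set V) (v w : V) : Prop :=
  v ≠ w ∧ ∃ u ∉ X, G.Adj v u ∧ (G.Adj u w ∨ ∃ u' ∉ X, G.Adj u u' ∧ G.Adj u' w)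

lemma IsEar.symm {V : Type*} {G : SimpleGraph V} {X : Set V} {v w : V} (h : IsEar G X v w) :
    IsEar G X w v := by
  obtain ⟨hne, u, hu, hvu, huw | ⟨u', hu', huu', huw⟩⟩ := h
  · exact ⟨hne.symm, u, hu, huw.symm, Or.inl hvu.symm⟩
  · exact ⟨hne.symm, u', hu', huw.symm, Or.inr ⟨u, hu, huu'.symm, hvu.symm⟩⟩

lemma IsEar.exists_walk {V : Type*} {G : SimpleGraph V} {X : Set V} {v w : V}
    (h : IsEar G X v w) : ∃ (u : V) (p : G.Walk v u), u ∉ X ∧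
      (∀ z ∈ p.support, z = v ∨ z ∉ X) ∧ G.Adj u w := by
  obtain ⟨-, u, hu, hvu, huw | ⟨u', hu', huu', huw⟩⟩ := h
  · exact ⟨u, .cons hvu .nil, hu, by simp [hu], huw⟩
  · exact ⟨u', .cons hvu (.cons huu' .nil), hu', by simp [hu, hu'], huw⟩

lemma IsCactus.isEar_unique {V : Type*} {G : SimpleGraph V} (hc : IsCactus G) {X A : Set V}
    (hAX : A ⊆ X) (hA : (G.induce A).Preconnected) {x a w₁ w₂ : V} (hx : x ∈ X) (hxA : x ∉ A)
    (ha : a ∈ A) (hax : G.Adj a x) (hw₁ : w₁ ∈ A) (hw₂ : w₂ ∈ A)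
    (h₁ : IsEar G X x w₁) (h₂ : IsEar G X x w₂) : w₁ = w₂ := by
  by_contra hne
  obtain ⟨u₁, p₁, hu₁, hp₁, hw₁u⟩ := h₁.exists_walk
  obtain ⟨u₂, p₂, hu₂, hp₂, hw₂u⟩ := h₂.exists_walk
  have hD := induce_union_connected p₁.connected_induce_support.preconnected
    p₂.connected_induce_support.preconnected ⟨x, p₁.start_mem_support, p₂.start_mem_support⟩
  refine hc.not_three_edges hA hD.preconnected ?_ hw₁ hw₂ ha
    (Or.inl p₁.end_mem_support) (Or.inr p₂.end_mem_support) (Or.inl p₁.start_mem_support)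
    hw₁u.symm hw₂u.symm hax (Or.inl hne) (Or.inr fun h => hu₁ (h ▸ hx))
    (Or.inr fun h => hu₂ (h ▸ hx))
  rw [Set.disjoint_left]
  rintro z hzA (hz | hz)
  · exact (hp₁ z hz).elim (fun h => hxA (h ▸ hzA)) fun h => h (hAX hzA)
  · exact (hp₂ z hz).elim (fun h => hxA (h ▸ hzA)) fun h => h (hAX hzA)

/-- The ears over a connected set of vertices of a cactus form a bipartite graph. -/
lemma IsCactus.exists_bool_coloring_isEar {V : Type*} [Finite V] {G : SimpleGraph V}
    (hc : IsCactus G) {X : Set V} {r : V} (hr : r ∈ X)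
    (hX : ∀ y ∈ X, ∃ p : G.Walk r y, ∀ z ∈ p.support, z ∈ X) :
    ∃ f : V → Bool, ∀ v ∈ X, ∀ w ∈ X, IsEar G X v w → f v ≠ f w := by
  classical
  let 𝒜 : Set (Set V) := {A | A ⊆ X ∧ r ∈ A ∧ (G.induce A).Preconnected ∧
    ∃ f : V → Bool, ∀ v ∈ A, ∀ w ∈ A, IsEar G X v w → f v ≠ f w}
  have h𝒜 : {r} ∈ 𝒜 := by
    refine ⟨by simpa using hr, rfl, ?_, fun _ => true, ?_⟩
    · rintro ⟨a, rfl⟩ ⟨b, rfl⟩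
      rfl
    · rintro v rfl w rfl h
      exact (h.1 rfl).elim
  obtain ⟨A, ⟨hAX, hrA, hA, f, hf⟩, hmax⟩ := (Set.toFinite 𝒜).exists_maximal ⟨_, h𝒜⟩
  suffices h : X ⊆ A from ⟨f, fun v hv w hw => hf v (h hv) w (h hw)⟩
  intro y hy
  by_contra hyA
  obtain ⟨p, hp⟩ := hX y hy
  obtain ⟨d, hd, hdA, hdA'⟩ := p.exists_boundary_dart A hrA hyA
  set a := d.fst
  set x := d.snd
  have hxX : x ∈ X := hp _ (p.dart_snd_mem_support_of_mem_darts hd)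
  have hax : G.Adj a x := d.adj
  have huniq : ∀ w₁ ∈ A, ∀ w₂ ∈ A, IsEar G X x w₁ → IsEar G X x w₂ → w₁ = w₂ :=
    fun w₁ hw₁ w₂ hw₂ => hc.isEar_unique hAX hA hxX hdA' hdA hax hw₁ hw₂
  obtain ⟨b, hb⟩ : ∃ b : Bool, ∀ w ∈ A, IsEar G X x w → b ≠ f w := by
    by_cases h : ∃ w ∈ A, IsEar G X x w
    · obtain ⟨w, hw, hxw⟩ := h
      refine ⟨!f w, fun w' hw' hxw' => ?_⟩
      rw [huniq w' hw' w hw hxw' hxw]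
      simp
    · exact ⟨true, fun w hw hxw => (h ⟨w, hw, hxw⟩).elim⟩
  refine hdA' (hmax (y := A ∪ {a, x}) ⟨?_, Or.inl hrA, ?_, Function.update f x b, ?_⟩
    Set.subset_union_left (by simp))
  · rintro z (hz | rfl | rfl)
    exacts [hAX hz, hAX hdA, hxX]
  · exact (induce_union_connected hA (induce_pair_connected_of_adj hax).preconnected
      ⟨a, hdA, by simp⟩).preconnected
  · have hsplit : ∀ z ∈ A ∪ {a, x}, z = x ∨ (z ≠ x ∧ z ∈ A) := by
      rintro z (hz | rfl | rfl)
      · exact Or.inr ⟨fun h => hdA' (h ▸ hz), hz⟩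
      · exact Or.inr ⟨hax.ne, hdA⟩
      · exact Or.inl rfl
    intro v hv w hw hvw
    rcases hsplit v hv with rfl | ⟨hvx, hv⟩ <;> rcases hsplit w hw with rfl | ⟨hwx, hw⟩
    · exact (hvw.1 rfl).elim
    · simpa [hwx] using hb w hw hvw
    · simpa [hvx] using (hb v hv hvw.symm).symm
    · simpa [hvx, hwx] using hf v hv w hw hvw

/-- The component of `r` in the subgraph induced by the vertices of color at least `s`. -/
def levelComponent {V : Type*} (G : SimpleGraph V) (g : V → ℕ) (r : V) (s : ℕ) : Set V :=
  {v | ∃ p : G.Walk r v, ∀ z ∈ p.support, s ≤ g z}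

section LevelComponent

variable {V : Type*} {G : SimpleGraph V} {g : V → ℕ} {r : V} {s : ℕ}

lemma self_mem_levelComponent (h : s ≤ g r) : r ∈ levelComponent G g r s :=
  ⟨.nil, by simpa using h⟩

lemma le_of_mem_levelComponent {v : V} (h : v ∈ levelComponent G g r s) : s ≤ g v := by
  obtain ⟨p, hp⟩ := h
  exact hp v p.end_mem_support

lemma mem_levelComponent_of_adj {v w : V} (h : v ∈ levelComponent G g r s) (hvw : G.Adj v w)
    (hw : s ≤ g w) : w ∈ levelComponent G g r s := by
  obtain ⟨p, hp⟩ := h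
  refine ⟨p.concat hvw, fun z hz => ?_⟩
  rw [Walk.support_concat, List.mem_append, List.mem_singleton] at hz
  rcases hz with hz | rfl
  exacts [hp z hz, hw]

lemma levelComponent_anti {s' : ℕ} (h : s ≤ s') :
    levelComponent G g r s' ⊆ levelComponent G g r s :=
  fun _ ⟨p, hp⟩ => ⟨p, fun z hz => h.trans (hp z hz)⟩

lemma exists_walk_levelComponent {v : V} (h : v ∈ levelComponent G g r s) :
    ∃ p : G.Walk r v, ∀ z ∈ p.support, z ∈ levelComponent G g r s := by
  classical
  obtain ⟨p, hp⟩ := h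
  exact ⟨p, fun z hz =>
    ⟨p.takeUntil z hz, fun y hy => hp y (p.support_takeUntil_subset_support hz hy)⟩⟩

lemma connected_induce_levelComponent (h : s ≤ g r) :
    (G.induce (levelComponent G g r s)).Connected := by
  refine G.induce_connected_of_patches r (self_mem_levelComponent h) fun hv => ?_
  obtain ⟨p, hp⟩ := exists_walk_levelComponent hv
  exact ⟨{z | z ∈ p.support}, hp, p.start_mem_support, p.end_mem_support,
    p.connected_induce_support.preconnected _ _⟩

variable [Finite V]

/-- The sizes of the level components of a Grundy coloring of a cactus. -/
lemma IsCactus.three_mul_ncard_levelComponent (hc : IsCactus G)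
    (hg : ∀ v, ∀ i, 1 ≤ i → i < g v → ∃ w, G.Adj v w ∧ g w = i) {c : ℕ} (hcr : c < g r) :
    3 + 2 * ∑ j ∈ Finset.range c, (levelComponent G g r (g r - j)).ncard ≤
      3 * (levelComponent G g r (g r - c)).ncard := by
  classical
  have := Fintype.ofFinite V
  choose! nb hnb hgnb using hg
  let X : ℕ → Set V := fun j => levelComponent G g r (g r - j)
  have hbound := (hc.induce (X c)).two_mul_card_edgeFinset_le
    (connected_induce_levelComponent (Nat.sub_le _ _))
  rw [← Nat.card_eq_fintype_card, Nat.card_coe_set_eq] at hbound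
  let P : Finset (Σ _ : ℕ, V) := (Finset.range c).sigma fun j => (X j).toFinset
  let φ : (Σ _ : ℕ, V) → Sym2 V := fun q => s(q.2, nb q.2 (g r - q.1 - 1))
  have hP : ∀ q ∈ P, q.1 < c ∧ q.2 ∈ X q.1 ∧ 1 ≤ g r - q.1 - 1 ∧
      g r - c ≤ g r - q.1 - 1 ∧ g r - q.1 - 1 < g q.2 := by
    intro q hq
    simp only [P, Finset.mem_sigma, Finset.mem_range, Set.mem_toFinset] at hq
    have := le_of_mem_levelComponent hq.2
    refine ⟨hq.1, hq.2, ?_, ?_, ?_⟩ <;> omega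
  have hle : P.card ≤ (G.induce (X c)).edgeFinset.card := by
    refine (Finset.card_le_card_of_injOn (t := (G.induce (X c)).edgeFinset.image
      (Sym2.map Subtype.val)) φ ?_ ?_).trans Finset.card_image_le
    · intro q hq
      obtain ⟨h1, h2, h3, h4, h5⟩ := hP q hq
      have hq2 : q.2 ∈ X c := levelComponent_anti (by omega) h2
      have hadj := hnb q.2 _ h3 h5
      have hn : nb q.2 (g r - q.1 - 1) ∈ X c :=
        mem_levelComponent_of_adj hq2 hadj (by rw [hgnb _ _ h3 h5]; exact h4)
      rw [Finset.mem_coe, Finset.mem_image]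
      exact ⟨s(⟨_, hq2⟩, ⟨_, hn⟩), by simpa using hadj, rfl⟩
    · rintro ⟨i, x⟩ hq ⟨j, y⟩ hq' heq
      obtain ⟨h1, -, h3, -, h5⟩ := hP _ hq
      obtain ⟨h1', -, h3', -, h5'⟩ := hP _ hq'
      have e1 := hgnb _ _ h3 h5
      have e2 := hgnb _ _ h3' h5'
      simp only [φ, Sym2.eq_iff] at heq h1 h1' h3 h3' h5 h5' e1 e2
      rcases heq with ⟨rfl, h⟩ | ⟨h, h'⟩
      · rw [h, e2] at e1
        obtain rfl : i = j := by omega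
        rfl
      · rw [← h] at e2
        rw [h'] at e1
        omega
  have hPcard : P.card = ∑ j ∈ Finset.range c, (X j).ncard := by
    simp only [P, Finset.card_sigma, Set.ncard_eq_toFinset_card']
  change 3 + 2 * ∑ j ∈ Finset.range c, (X j).ncard ≤ 3 * (X c).ncard
  rw [← hPcard, add_comm]
  refine le_trans ?_ hbound
  gcongr
  exact hle.trans_eq (by congr!)

lemma IsCactus.five_thirds_pow_le (hc : IsCactus G)
    (hg : ∀ v, ∀ i, 1 ≤ i → i < g v → ∃ w, G.Adj v w ∧ g w = i) {c : ℕ} (hcr : c < g r) :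
    (5 / 3 : ℚ) ^ c ≤ (levelComponent G g r (g r - c)).ncard := by
  induction c using Nat.strong_induction_on with
  | _ c ih =>
    have h := hc.three_mul_ncard_levelComponent hg hcr
    have hsum : ∑ j ∈ Finset.range c, (5 / 3 : ℚ) ^ j ≤
        ∑ j ∈ Finset.range c, ((levelComponent G g r (g r - j)).ncard : ℚ) :=
      Finset.sum_le_sum fun j hj =>
        ih j (Finset.mem_range.1 hj) ((Finset.mem_range.1 hj).trans hcr)
    rw [geom_sum_eq (by norm_num)] at hsum
    have h' : (3 : ℚ) + 2 * ∑ j ∈ Finset.range c, ((levelComponent G g r (g r - j)).ncard : ℚ) ≤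
        3 * (levelComponent G g r (g r - c)).ncard := by exact_mod_cast h
    have hdiv : ((5 / 3 : ℚ) ^ c - 1) / (5 / 3 - 1) = 3 / 2 * ((5 / 3) ^ c - 1) := by ring
    linarith

end LevelComponent

lemma two_pow_add_two_le (L : ℕ) : (2 : ℚ) ^ (L + 2) ≤ (5 / 3) ^ (2 * L) + 3 + 4 * L := by
  rcases lt_or_ge L 5 with hL | hL
  · interval_cases L <;> norm_num
  · have : (2 : ℚ) ^ (L + 2) ≤ (5 / 3) ^ (2 * L) := by
      induction L, hL using Nat.le_induction with
      | base => norm_num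
      | succ n _ ih =>
        rw [show n + 1 + 2 = (n + 2) + 1 by ring, show 2 * (n + 1) = 2 * n + 2 by ring,
          pow_succ, pow_add (5 / 3 : ℚ)]
        have : (0 : ℚ) < (5 / 3) ^ (2 * n) := by positivity
        nlinarith
    have hL0 : (0 : ℚ) ≤ L := Nat.cast_nonneg L
    linarith

lemma le_card_of_isBColoring {V : Type*} [Fintype V] {G : SimpleGraph V} {k : ℕ} {c : V → ℕ}
    (h : IsBColoring G k c) : k ≤ Fintype.card V := by
  classical
  have : Finset.Icc 1 k ⊆ Finset.univ.image c := by
    intro i hi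
    obtain ⟨v, hv, -⟩ := h.2.2 i hi
    exact Finset.mem_image.2 ⟨v, Finset.mem_univ _, hv⟩
  simpa using (Finset.card_le_card this).trans Finset.card_image_le

lemma le_bChromatic_of_isBColoring {V : Type*} [Fintype V] {G : SimpleGraph V} {k : ℕ}
    {c : V → ℕ} (h : IsBColoring G k c) : k ≤ bChromatic G :=
  le_csSup ⟨Fintype.card V, fun _ ⟨_, h'⟩ => le_card_of_isBColoring h'⟩ ⟨c, h⟩

lemma exists_isGrundyColoring_grundyNumber {V : Type*} [Fintype V] {G : SimpleGraph V}
    (h : 0 < grundyNumber G) : ∃ c : V → ℕ, IsGrundyColoring G (grundyNumber G) c := by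
  classical
  have hne : {k | ∃ c : V → ℕ, IsGrundyColoring G k c}.Nonempty := by
    rw [Set.nonempty_iff_ne_empty]
    intro he
    simp [grundyNumber, he] at h
  refine Nat.sSup_mem hne ⟨Fintype.card V, ?_⟩
  rintro k ⟨c, hc⟩
  have : Finset.Icc 1 k ⊆ Finset.univ.image c := by
    intro i hi
    obtain ⟨v, hv⟩ := hc.2.2.1 i hi
    exact Finset.mem_image.2 ⟨v, Finset.mem_univ _, hv⟩
  simpa using (Finset.card_le_card this).trans Finset.card_image_le

/-- If `t` vertices of color at least `t` in a Grundy-type coloring are pairwise not joined by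
ears, then they and suitable neighbors of smaller color induce a graph with a b-coloring with
`t` colors, in which they are the color-dominating vertices. -/
lemma BMonotone.le_bChromatic {V : Type*} [Fintype V] {G : SimpleGraph V} (hb : BMonotone G)
    {g : V → ℕ} (hprop : IsProperNat G g)
    (hg : ∀ v, ∀ i, 1 ≤ i → i < g v → ∃ w, G.Adj v w ∧ g w = i)
    {t : ℕ} {X : Set V} (hX : ∀ v ∈ X, t ≤ g v) {C : Finset V} (hCX : ∀ v ∈ C, v ∈ X)
    (hCt : C.card = t) (hear : ∀ v ∈ C, ∀ w ∈ C, ¬ IsEar G X v w) : t ≤ bChromatic G := by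
  classical
  choose! L hL hgL using hg
  obtain ⟨e⟩ : Nonempty (C ≃ Finset.Icc 1 t) :=
    Fintype.card_eq.1 (by simp [hCt])
  let idx : V → ℕ := fun v => if h : v ∈ C then e ⟨v, h⟩ else 0
  have hidx : ∀ v ∈ C, 1 ≤ idx v ∧ idx v ≤ t := by
    intro v hv
    simpa only [idx, dif_pos hv] using Finset.mem_Icc.1 (e ⟨v, hv⟩).2
  have hinj : ∀ v ∈ C, ∀ w ∈ C, idx v = idx w → v = w := by
    intro v hv w hw h
    simpa [idx, hv, hw, Subtype.val_inj] using h
  have hsurj : ∀ i ∈ Finset.Icc 1 t, ∃ v ∈ C, idx v = i := by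
    intro i hi
    exact ⟨(e.symm ⟨i, hi⟩).1, (e.symm ⟨i, hi⟩).2, by simp [idx]⟩
  have hadjL : ∀ v ∈ C, ∀ i, 1 ≤ i → i < t → G.Adj v (L v i) ∧ g (L v i) = i := by
    intro v hv i h1 h2
    have := h2.trans_le (hX v (hCX v hv))
    exact ⟨hL v i h1 this, hgL v i h1 this⟩
  have hout : ∀ u, g u < t → u ∉ X := fun u hu h => (hX u h).not_gt hu
  have hcommon : ∀ v ∈ C, ∀ w ∈ C, ∀ u, g u < t → G.Adj v u → G.Adj w u → v = w := by
    intro v hv w hw u hu hvu hwu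
    by_contra hne
    exact hear v hv w hw ⟨hne, u, hout u hu, hvu, Or.inl hwu.symm⟩
  have hlink : ∀ v ∈ C, ∀ w ∈ C, ∀ u u', g u < t → g u' < t → G.Adj v u → G.Adj w u' →
      G.Adj u u' → v = w := by
    intro v hv w hw u u' hu hu' hvu hwu' huu'
    by_contra hne
    exact hear v hv w hw ⟨hne, u, hout u hu, hvu, Or.inr ⟨u', hout u' hu', huu', hwu'.symm⟩⟩
  let R : V → Prop := fun u => ∃ v ∈ C, idx v < t ∧ u = L v (idx v)
  let h : V → ℕ := fun u => if u ∈ C then idx u else if R u then t else g u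
  let Λ : Set V := {u | ∃ v ∈ C, ∃ i, 1 ≤ i ∧ i < t ∧ u = L v i}
  have hΛ : ∀ u ∈ Λ, 1 ≤ g u ∧ g u < t ∧ u ∉ C ∧ ∃ v ∈ C, G.Adj v u ∧ u = L v (g u) := by
    rintro u ⟨v, hv, i, h1, h2, hu⟩
    obtain ⟨ha, hgi⟩ := hadjL v hv i h1 h2
    rw [← hu] at ha hgi
    rw [hgi]
    exact ⟨h1, h2, fun hm => hout u (hgi.trans_lt h2) (hCX u hm), v, hv, ha, hu⟩
  have hR : ∀ v ∈ C, ∀ u ∈ Λ, G.Adj v u → R u → u = L v (idx v) := by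
    rintro v hv u hu hvu ⟨w, hw, hwt, rfl⟩
    rw [hcommon v hv w hw _ (hΛ _ hu).2.1 hvu (hadjL w hw _ (hidx w hw).1 hwt).1]
  have hcenter : ∀ v ∈ C, h v = idx v := fun v hv => by simp [h, hv]
  have hrec : ∀ u ∈ Λ, R u → h u = t := fun u hu hr => by simp [h, (hΛ u hu).2.2.1, hr]
  have hkeep : ∀ u ∈ Λ, ¬ R u → h u = g u := fun u hu hr => by simp [h, (hΛ u hu).2.2.1, hr]
  have hCL : ∀ v ∈ C, ∀ u ∈ Λ, G.Adj v u → h v ≠ h u := by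
    intro v hv u hu hvu heq
    obtain ⟨h1, h2, -, w, hw, hwu, huL⟩ := hΛ u hu
    obtain rfl := hcommon v hv w hw u h2 hvu hwu
    rw [hcenter v hv] at heq
    by_cases hr : R u
    · obtain ⟨w, hw, hwt, hwL⟩ := hr
      have hvw := hcommon v hv w hw u h2 hvu (hwL ▸ (hadjL w hw _ (hidx w hw).1 hwt).1)
      rw [hrec u hu ⟨w, hw, hwt, hwL⟩, hvw] at heq
      omega
    · rw [hkeep u hu hr] at heq
      exact hr ⟨v, hv, heq ▸ h2, heq ▸ huL⟩
  have hLL : ∀ u ∈ Λ, ∀ u' ∈ Λ, G.Adj u u' → h u ≠ h u' := by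
    intro u hu u' hu' huu'
    have h2 := (hΛ u hu).2.1
    have h2' := (hΛ u' hu').2.1
    by_cases hr : R u <;> by_cases hr' : R u'
    · obtain ⟨v, hv, hvt, hvL⟩ := hr
      obtain ⟨w, hw, hwt, hwL⟩ := hr'
      have hvw := hlink v hv w hw u u' h2 h2' (hvL ▸ (hadjL v hv _ (hidx v hv).1 hvt).1)
        (hwL ▸ (hadjL w hw _ (hidx w hw).1 hwt).1) huu'
      exact (huu'.ne (by rw [hvL, hwL, hvw])).elim
    · rw [hrec u hu hr, hkeep u' hu' hr']
      omega
    · rw [hkeep u hu hr, hrec u' hu' hr']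
      omega
    · rw [hkeep u hu hr, hkeep u' hu' hr']
      exact hprop huu'
  let H : Set V := {u | u ∈ C ∨ u ∈ Λ}
  refine (le_bChromatic_of_isBColoring (G := G.induce H) (c := fun u => h u) ⟨?_, ?_, ?_⟩).trans
    (hb H)
  · rintro ⟨u, hu | hu⟩ <;> rw [Finset.mem_Icc]
    · simpa only [hcenter u hu] using hidx u hu
    · have := hΛ u hu
      by_cases hr : R u
      · simp only [hrec u hu hr]
        omega
      · simp only [hkeep u hu hr]
        omega
  · rintro ⟨u, hu | hu⟩ ⟨w, hw | hw⟩ huw <;> replace huw : G.Adj u w := huw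
    · change h u ≠ h w
      rw [hcenter u hu, hcenter w hw]
      exact fun heq => huw.ne (hinj u hu w hw heq)
    · exact hCL u hu w hw huw
    · exact (hCL w hw u hu huw.symm).symm
    · exact hLL u hu w hw huw
  · intro i hi
    obtain ⟨v, hv, rfl⟩ := hsurj i hi
    refine ⟨⟨v, Or.inl hv⟩, hcenter v hv, fun j hj hji => ?_⟩
    rw [Finset.mem_Icc] at hi hj
    rcases hj.2.lt_or_eq with hjt | rfl
    · obtain ⟨ha, hgj⟩ := hadjL v hv j hj.1 hjt
      have hmem : L v j ∈ Λ := ⟨v, hv, j, hj.1, hjt, rfl⟩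
      refine ⟨⟨L v j, Or.inr hmem⟩, ha, ?_⟩
      change h (L v j) = j
      rw [hkeep _ hmem, hgj]
      intro hr
      have := hR v hv _ hmem ha hr
      obtain ⟨w, hw, hwt, hwL⟩ := hr
      have hvw := hcommon v hv w hw _ (hgj.trans_lt hjt) ha
        (hwL ▸ (hadjL w hw _ (hidx w hw).1 hwt).1)
      rw [← hvw] at hwt
      rw [this, (hadjL v hv _ hi.1 hwt).2] at hgj
      exact hji hgj.symm
    · have hit : idx v < j := lt_of_le_of_ne hi.2 (Ne.symm hji)
      have hmem : L v (idx v) ∈ Λ := ⟨v, hv, _, hi.1, hit, rfl⟩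
      exact ⟨⟨L v (idx v), Or.inr hmem⟩, (hadjL v hv _ hi.1 hit).1,
        hrec _ hmem ⟨v, hv, hit, rfl⟩⟩

/-- A finite set of vertices has half of its elements in one class of a `Bool` coloring. -/
lemma exists_subset_card_eq_of_bool {V : Type*} (X : Finset V) (f : V → Bool) {t : ℕ}
    (h : 2 * t ≤ X.card + 1) :
    ∃ C ⊆ X, C.card = t ∧ ∀ v ∈ C, ∀ w ∈ C, f v = f w := by
  have hsum := X.card_filter_add_card_filter_not (p := fun v => f v = true)
  obtain hle | hle : t ≤ (X.filter fun v => f v = true).card ∨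
      t ≤ (X.filter fun v => ¬ f v = true).card := by omega
  all_goals
    obtain ⟨C, hC, hCt⟩ := Finset.exists_subset_card_eq hle
    refine ⟨C, hC.trans (Finset.filter_subset _ _), hCt, fun v hv w hw => ?_⟩
    have hv' := (Finset.mem_filter.1 (hC hv)).2
    have hw' := (Finset.mem_filter.1 (hC hw)).2
    simp_all

/-- for a b-monotone cactus graph `G` with `Γ(G) = k`,
`b(G) ≥ k - 2⌊log₂ k⌋`. -/
theorem cactus_grundy_le_bChromatic {V : Type*} [Fintype V] (G : SimpleGraph V)
    (hc : IsCactus G) (hb : BMonotone G) :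
    grundyNumber G - 2 * Nat.log 2 (grundyNumber G) ≤ bChromatic G := by
  classical
  set k := grundyNumber G with hk
  set L := Nat.log 2 k with hL
  by_cases hkL : k ≤ 2 * L
  · omega
  obtain ⟨g, hgk, hprop, hsurj, hg⟩ := exists_isGrundyColoring_grundyNumber (G := G) (by omega)
  obtain ⟨r, hr⟩ := hsurj k (Finset.mem_Icc.2 ⟨by omega, le_rfl⟩)
  have hpow := hc.five_thirds_pow_le hg (r := r) (c := 2 * L) (by omega)
  rw [hr] at hpow
  set X := levelComponent G g r (k - 2 * L)
  have hcard : 2 * (k - 2 * L) ≤ X.toFinset.card + 1 := by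
    rw [← Set.ncard_eq_toFinset_card']
    have hklt : k < 2 ^ (L + 1) := Nat.lt_pow_succ_log_self one_lt_two k
    have hnum : 2 ^ (L + 2) ≤ X.ncard + 3 + 4 * L := by
      have : (2 : ℚ) ^ (L + 2) ≤ X.ncard + 3 + 4 * L := by linarith [two_pow_add_two_le L]
      exact_mod_cast this
    rw [pow_succ] at hnum
    omega
  obtain ⟨f, hf⟩ := hc.exists_bool_coloring_isEar (X := X)
    (self_mem_levelComponent (by omega)) fun y hy => exists_walk_levelComponent hy
  obtain ⟨C, hCX, hCt, hCf⟩ := exists_subset_card_eq_of_bool X.toFinset f hcard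
  have hCX' : ∀ v ∈ C, v ∈ X := fun v hv => Set.mem_toFinset.1 (hCX hv)
  exact hb.le_bChromatic hprop hg (fun v hv => le_of_mem_levelComponent hv) hCX' hCt
    fun v hv w hw h => hf v (hCX' v hv) w (hCX' w hw) h (hCf v hv w hw)
end

section
/- Let G be a graph of girth at least 6. Then ⌊2Γ(G)/3⌋ ≤ b(G). -/
open SimpleGraph

/-- A graph without cycles of length at most five. -/
structure NoShortCycle {V : Type*} (G : SimpleGraph V) : Prop where
  no_triangle : ∀ {a b c}, G.Adj a b → G.Adj b c → G.Adj c a → False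
  common_unique : ∀ {x y a b}, G.Adj x a → G.Adj x b → G.Adj y a → G.Adj y b → x ≠ y → a = b
  no_pentagon : ∀ {a b c d e}, G.Adj a b → G.Adj b c → G.Adj c d → G.Adj d e → G.Adj e a → False

theorem NoShortCycle.of_girth {V : Type*} {G : SimpleGraph V} (h : 6 ≤ G.girth) :
    NoShortCycle G := by
  have key : ∀ {v : V} (w : G.Walk v v), w.IsCycle → 6 ≤ w.length := fun w hw =>
    h.trans hw.girth_le_length
  have h3 : ∀ {a b c}, G.Adj a b → G.Adj b c → G.Adj c a → False := by
    intro a b c h1 h2 h3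
    have := key (.cons h1 (.cons h2 (.cons h3 .nil))) (by
      have := h1.ne; have := h2.ne; have := h3.ne
      simp [SimpleGraph.Walk.cons_isCycle_iff]; grind)
    simp at this
  refine ⟨h3, ?_, ?_⟩
  · intro x y a b h1 h2 h3 h4 hne
    by_contra hab
    have := key (.cons h1 (.cons h3.symm (.cons h4 (.cons h2.symm .nil)))) (by
      have := h1.ne; have := h2.ne; have := h3.ne; have := h4.ne
      simp [SimpleGraph.Walk.cons_isCycle_iff]; grind)
    simp at this
  · intro a b c d e h1 h2 h4 h5 h6
    have := key (.cons h1 (.cons h2 (.cons h4 (.cons h5 (.cons h6 .nil))))) (by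
      have := h1.ne; have := h2.ne; have := h4.ne; have := h5.ne; have := h6.ne
      have : a ≠ c := by rintro rfl; exact h3 h4 h5 h6
      have : a ≠ d := by rintro rfl; exact h3 h1 h2 h4
      have : b ≠ d := by rintro rfl; exact h3 h5 h6 h1
      have : b ≠ e := by rintro rfl; exact h3 h2 h4 h5
      have : c ≠ e := by rintro rfl; exact h3 h1 h2 h6
      simp [SimpleGraph.Walk.cons_isCycle_iff]; grind)
    simp at this

/-- A Hall-type condition: few conflicts on both sides leave room for a conflict-free matching. -/
theorem exists_injOn_avoiding {ι α : Type*} [Nonempty α]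
    (J : Finset ι) (W : Finset α) (B : ι → α → Prop)
    [∀ j y, Decidable (B j y)] (p : ℕ)
    (hJW : J.card ≤ W.card) (hp : 2 * p ≤ W.card)
    (hJ : ∀ j ∈ J, (W.filter (B j)).card ≤ p)
    (hW : ∀ y ∈ W, (J.filter fun j => B j y).card ≤ p) :
    ∃ f : ι → α, Set.InjOn f J ∧ ∀ j ∈ J, f j ∈ W ∧ ¬ B j (f j) := by
  classical
  have hall : ∀ s : Finset J,
      s.card ≤ (s.biUnion fun j : J => W.filter fun y => ¬ B j y).card := by
    intro s
    obtain rfl | ⟨j, hj⟩ := s.eq_empty_or_nonempty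
    · simp
    have hsJ : s.card ≤ J.card := by simpa using s.card_le_univ
    by_cases hs : s.card + p ≤ W.card
    · have h1 := Finset.card_filter_add_card_filter_not (s := W) (B j)
      have h2 := hJ j j.2
      have h3 : (W.filter fun y => ¬ B j y).card ≤
          (s.biUnion fun j : J => W.filter fun y => ¬ B j y).card :=
        Finset.card_le_card (Finset.subset_biUnion_of_mem
          (fun j : J => W.filter fun y => ¬ B j y) hj)
      omega
    · refine (hsJ.trans hJW).trans (Finset.card_le_card fun y hy => ?_)
      by_contra hcon
      have hsub : s.map (Function.Embedding.subtype _) ⊆ J.filter fun j => B j y := by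
        intro i hi
        simp only [Finset.mem_map, Function.Embedding.subtype_apply] at hi
        obtain ⟨i, hi, rfl⟩ := hi
        simp only [Finset.mem_biUnion, Finset.mem_filter, not_exists, not_and, not_not] at hcon
        exact Finset.mem_filter.2 ⟨i.2, hcon i hi hy⟩
      have h1 := Finset.card_le_card hsub
      have h2 := hW y hy
      rw [Finset.card_map] at h1
      omega
  obtain ⟨f, hf, hft⟩ := (Finset.all_card_le_biUnion_card_iff_exists_injective _).1 hall
  refine ⟨fun j => if h : j ∈ J then f ⟨j, h⟩ else Classical.arbitrary α, ?_, ?_⟩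
  · intro a ha b hb hab
    simp only [Finset.mem_coe] at ha hb
    simpa [ha, hb, hf.eq_iff] using hab
  · intro j hj
    simpa [hj] using hft ⟨j, hj⟩

/-- `v` has a color in `1, …, b` and neighbors of all the other ones; color `0` means uncolored. -/
def Dominates {V : Type*} (G : SimpleGraph V) (b : ℕ) (c : V → ℕ) (v : V) : Prop :=
  c v ∈ Finset.Icc 1 b ∧ ∀ j ∈ Finset.Icc 1 b, j ≠ c v → ∃ w, G.Adj v w ∧ c w = j

/-- A proper coloring of part of the graph, the color `0` meaning uncolored. -/
structure IsPartialColoring {V : Type*} (G : SimpleGraph V) (b : ℕ) (c : V → ℕ) : Prop where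
  le : ∀ v, c v ≤ b
  proper : ∀ {v w}, G.Adj v w → c v ≠ 0 → c v ≠ c w

/-- A b-coloring of part of the graph in which two color-dominating vertices are adjacent. -/
structure IsLinkedBColoring {V : Type*} (G : SimpleGraph V) (b : ℕ) (c : V → ℕ) : Prop
    extends IsPartialColoring G b c where
  rep : ∀ i ∈ Finset.Icc 1 b, ∃ v, Dominates G b c v ∧ c v = i
  link : ∃ v w, G.Adj v w ∧ Dominates G b c v ∧ Dominates G b c w

section Recolor

variable {V : Type*} {G : SimpleGraph V} {b : ℕ} {c : V → ℕ}

theorem IsPartialColoring.recolor (hc : IsPartialColoring G b c) (M : Set V)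
    [DecidablePred (· ∈ M)] (m : V → ℕ)
    (hM : ∀ v ∈ M, ∀ w ∈ M, ¬ G.Adj v w)
    (hm : ∀ v ∈ M, m v ∈ Finset.Icc 1 b ∧ ∀ w, G.Adj v w → c w ≠ m v) :
    IsPartialColoring G b (fun v => if v ∈ M then m v else c v) := by
  constructor
  · intro v
    have := hc.le v
    have := hm v
    grind
  · intro v w hvw h0
    have h1 := hM v
    have h2 := hm v
    have h3 := hm w
    have := hvw.symm
    have := @hc.proper v w hvw
    grind

theorem IsPartialColoring.mono (hc : IsPartialColoring G b c) {b' : ℕ} (h : b ≤ b') :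
    IsPartialColoring G b' c :=
  ⟨fun v => (hc.le v).trans h, hc.proper⟩

/-- Injections of a set of colors into itself are onto, so distinct representatives which block
every color of the set are all blockers. -/
theorem forall_blocked (hG : NoShortCycle G) {x : V} {S : Finset ℕ} {r : ℕ → V}
    (hx : ∀ j ∈ S, r j ≠ x)
    (hr : ∀ i ∈ S, ∃ j ∈ S, ∃ y, G.Adj x y ∧ c y = i ∧ G.Adj (r j) y) :
    ∀ j ∈ S, ∃ y, G.Adj x y ∧ c y ∈ S ∧ G.Adj (r j) y := by
  choose! τ hτ y hy using hr
  have hinj : Set.InjOn τ S := by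
    intro i hi i' hi' h
    have h1 := hy i hi
    have h2 := hy i' hi'
    have := hG.common_unique h1.1 h2.1 h1.2.2 (h ▸ h2.2.2) (hx _ (hτ i hi)).symm
    rw [← h1.2.1, ← h2.2.1, this]
  intro j hj
  obtain ⟨i, hi, rfl⟩ := Finset.surjOn_of_injOn_of_card_le τ hτ hinj le_rfl hj
  have := hy i hi
  exact ⟨y i hi, this.1, this.2.1.symm ▸ hi, this.2.2⟩

theorem Dominates.congr {c' : V → ℕ} {v : V} (h : Dominates G b c v) (hv : c' v = c v)
    (hn : ∀ w, G.Adj v w → c w ≠ 0 → c' w = c w) : Dominates G b c' v := by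
  refine ⟨hv ▸ h.1, fun j hj hjv => ?_⟩
  obtain ⟨w, hw, rfl⟩ := h.2 j hj (hv ▸ hjv)
  exact ⟨w, hw, hn w hw (by simp at hj; omega)⟩

/-- A linked b-coloring extends to an uncolored vertex which misses some color. -/
theorem IsLinkedBColoring.extend_missing (hc : IsLinkedBColoring G b c) {x : V} (hx : c x = 0)
    {i : ℕ} (hi : i ∈ Finset.Icc 1 b) (hxi : ∀ y, G.Adj x y → c y ≠ i) :
    ∃ c', IsLinkedBColoring G b c' ∧ c' x ≠ 0 ∧ ∀ v, c v ≠ 0 → c' v ≠ 0 := by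
  classical
  set c' : V → ℕ := fun v => if v ∈ ({x} : Set V) then i else c v with hc'
  have hp : IsPartialColoring G b c' :=
    hc.recolor {x} (fun _ => i) (by simp) (by simpa using ⟨by simpa using hi, hxi⟩)
  have heq : ∀ v, c v ≠ 0 → c' v = c v := by grind
  have hdom : ∀ {v}, Dominates G b c v → Dominates G b c' v := fun {v} h =>
    h.congr (heq _ (by have := h.1; simp at this; omega)) fun w _ h0 => heq w h0
  refine ⟨c', ⟨hp, fun j hj => ?_, ?_⟩, ?_, fun v hv => heq v hv ▸ hv⟩
  · obtain ⟨v, hv, rfl⟩ := hc.rep j hj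
    exact ⟨v, hdom hv, heq v (by simp at hj; omega)⟩
  · obtain ⟨v, w, hvw, hv, hw⟩ := hc.link
    exact ⟨v, w, hvw, hdom hv, hdom hw⟩
  · simp at hi; simp [hc']; omega

/-- A new color is available at a vertex with color-dominating neighbors of all colors. -/
theorem IsLinkedBColoring.extend_new_color (hc : IsLinkedBColoring G b c) {x : V} (hx : c x = 0)
    (hsee : ∀ i ∈ Finset.Icc 1 b, ∃ y, G.Adj x y ∧ Dominates G b c y ∧ c y = i) :
    ∃ c', IsLinkedBColoring G (b + 1) c' ∧ c' x ≠ 0 ∧ ∀ v, c v ≠ 0 → c' v ≠ 0 := by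
  classical
  set c' : V → ℕ := fun v => if v ∈ ({x} : Set V) then b + 1 else c v with hc'
  have hp : IsPartialColoring G (b + 1) c' := by
    refine (hc.mono b.le_succ).recolor {x} (fun _ => b + 1) (by simp) ?_
    have := hc.le
    simp only [Set.mem_singleton_iff, forall_eq, Finset.mem_Icc]
    exact ⟨by omega, fun w _ => by have := this w; omega⟩
  have heq : ∀ v, c v ≠ 0 → c' v = c v := by grind
  have hxb : c' x = b + 1 := by simp [hc']
  have hdx : Dominates G (b + 1) c' x := by
    refine ⟨by simp [hxb], fun j hj hjx => ?_⟩
    simp only [Finset.mem_Icc] at hj hsee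
    obtain ⟨y, hy, -, hyj⟩ := hsee j (by omega)
    exact ⟨y, hy, by rw [heq y (by omega), hyj]⟩
  have hdom : ∀ {y}, G.Adj x y → Dominates G b c y → Dominates G (b + 1) c' y := by
    intro y hy h
    have h1 := h.1
    simp only [Finset.mem_Icc] at h1
    have hy0 := heq y (by omega)
    refine ⟨by simp only [Finset.mem_Icc]; omega, fun j hj hjy => ?_⟩
    simp only [Finset.mem_Icc] at hj
    obtain rfl | hjb := eq_or_ne j (b + 1)
    · exact ⟨x, hy.symm, hxb⟩
    · obtain ⟨w, hw, hwj⟩ := h.2 j (by simp only [Finset.mem_Icc]; omega) (by omega)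
      exact ⟨w, hw, by rw [heq w (by omega), hwj]⟩
  refine ⟨c', ⟨hp, fun j hj => ?_, ?_⟩, by omega, fun v hv => heq v hv ▸ hv⟩
  · simp only [Finset.mem_Icc] at hj hsee
    obtain rfl | hjb := eq_or_ne j (b + 1)
    · exact ⟨x, hdx, hxb⟩
    · obtain ⟨y, hy, hd, hyj⟩ := hsee j (by omega)
      exact ⟨y, hdom hy hd, by rw [heq y (by omega), hyj]⟩
  · obtain ⟨v, w, -, hv, -⟩ := hc.link
    obtain ⟨y, hy, hd, -⟩ := hsee _ hv.1
    exact ⟨x, y, hy, hdx, hdom hy hd⟩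

theorem exists_missing_color {v : V} (hv : c v ∈ Finset.Icc 1 b) (hnd : ¬ Dominates G b c v) :
    ∃ j ∈ Finset.Icc 1 b, j ≠ c v ∧ ∀ w, G.Adj v w → c w ≠ j := by
  simp only [Dominates, hv, true_and] at hnd
  push Not at hnd
  exact hnd

/-- An uncolored vertex `x` takes a color `i` from its neighbors, none of which dominates, provided
that this does not affect a system of representatives. -/
theorem IsLinkedBColoring.extend_unblocked (hG : NoShortCycle G) (hc : IsLinkedBColoring G b c)
    {x : V} (hx : c x = 0) (hsee : ∀ i ∈ Finset.Icc 1 b, ∃ y, G.Adj x y ∧ c y = i)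
    {i : ℕ} (hi : i ∈ Finset.Icc 1 b) (hnd : ∀ y, G.Adj x y → c y = i → ¬ Dominates G b c y)
    {r : ℕ → V} (hr : ∀ j ∈ Finset.Icc 1 b, Dominates G b c (r j) ∧ c (r j) = j)
    (hri : ∀ j ∈ Finset.Icc 1 b, ∀ y, G.Adj x y → c y = i → ¬ G.Adj (r j) y)
    (hlink : (∃ d ∈ Finset.Icc 1 b, G.Adj x (r d)) ∨
      ∃ d ∈ Finset.Icc 1 b, ∃ e ∈ Finset.Icc 1 b, G.Adj (r d) (r e)) :
    ∃ c', IsLinkedBColoring G b c' ∧ c' x ≠ 0 ∧ ∀ v, c v ≠ 0 → c' v ≠ 0 := by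
  classical
  have hmiss : ∀ v, c v ∈ Finset.Icc 1 b → ¬ Dominates G b c v → ∃ j, j ∈ Finset.Icc 1 b ∧
    j ≠ c v ∧ ∀ w, G.Adj v w → c w ≠ j := fun v => exists_missing_color
  choose! m hm using hmiss
  set M : Set V := {y | G.Adj x y ∧ c y = i} with hM
  set c₁ : V → ℕ := fun v => if v ∈ M then m v else c v with hc₁
  set c' : V → ℕ := fun v => if v ∈ ({x} : Set V) then i else c₁ v with hc'
  have hmM : ∀ v ∈ M, m v ∈ Finset.Icc 1 b ∧ m v ≠ i ∧ ∀ w, G.Adj v w → c w ≠ m v :=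
    fun v hv => hv.2 ▸ hm v (hv.2 ▸ hi) (hnd v hv.1 hv.2)
  have h₁ : IsPartialColoring G b c₁ :=
    hc.recolor M m (fun v hv w hw h => hG.no_triangle hv.1 h hw.1.symm)
      fun v hv => ⟨(hmM v hv).1, (hmM v hv).2.2⟩
  have hp : IsPartialColoring G b c' := h₁.recolor {x} (fun _ => i) (by simp) (by grind)
  have heq : ∀ v, c v ≠ 0 → v ∉ M → c' v = c v := by grind
  have hxi : c' x = i := by simp [hc']
  simp only [Finset.mem_Icc] at hi hsee hr hri hlink hmM
  have hdx : Dominates G b c' x := by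
    refine ⟨by simpa [hxi] using hi, fun j hj hjx => ?_⟩
    simp only [Finset.mem_Icc] at hj
    obtain ⟨y, hy, rfl⟩ := hsee j hj
    exact ⟨y, hy, heq y (by omega) fun h => by have := h.2; omega⟩
  have hrj : ∀ j, 1 ≤ j ∧ j ≤ b → c' (r j) = j ∧ Dominates G b c' (r j) := by
    intro j hj
    obtain ⟨h1, h2⟩ := hr j hj
    have h3 : c' (r j) = c (r j) := heq _ (by omega) fun h => hnd _ h.1 h.2 h1
    exact ⟨h3.trans h2, h1.congr h3 fun w hw h0 => heq w h0 fun h => hri j hj w h.1 h.2 hw⟩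
  refine ⟨c', ⟨hp, fun j hj => ?_, ?_⟩, by omega, fun v hv => ?_⟩
  · simp only [Finset.mem_Icc] at hj
    exact ⟨r j, (hrj j hj).2, (hrj j hj).1⟩
  · obtain ⟨d, hd, h⟩ | ⟨d, hd, e, he, h⟩ := hlink
    · exact ⟨x, r d, h, hdx, (hrj d hd).2⟩
    · exact ⟨r d, r e, h, (hrj d hd).2, (hrj e he).2⟩
  · by_cases hvM : v ∈ M
    · have := hmM v hvM
      grind
    · exact heq v hv hvM ▸ hv

/-- An uncolored vertex `x` takes the color `i` of a dominating neighbor, and the latter takes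
a color `l` instead. -/
theorem IsLinkedBColoring.extend_trade (hG : NoShortCycle G) (hc : IsLinkedBColoring G b c)
    {x : V} (hx : c x = 0) (hsee : ∀ j ∈ Finset.Icc 1 b, ∃ y, G.Adj x y ∧ c y = j)
    {S : Finset ℕ} (hS : ∀ j ∈ Finset.Icc 1 b, j ∉ S → ∃ y, G.Adj x y ∧ Dominates G b c y ∧ c y = j)
    (hblock : ∀ z, Dominates G b c z → c z ∈ S → ∃ y, G.Adj x y ∧ c y ∈ S ∧ G.Adj z y)
    {i l : ℕ} (hi : i ∈ Finset.Icc 1 b) (hl : l ∈ Finset.Icc 1 b) (hiS : i ∉ S) (hlS : l ∈ S) :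
    ∃ c', IsLinkedBColoring G b c' ∧ c' x ≠ 0 ∧ ∀ v, c v ≠ 0 → c' v ≠ 0 := by
  classical
  have hmiss : ∀ v, c v ∈ Finset.Icc 1 b → ¬ Dominates G b c v → ∃ j, j ∈ Finset.Icc 1 b ∧
    j ≠ c v ∧ ∀ w, G.Adj v w → c w ≠ j := fun v => exists_missing_color
  choose! m hm using hmiss
  have hil : i ≠ l := fun h => hiS (h ▸ hlS)
  set M₁ : Set V := {w | c w = l ∧ ∃ u, G.Adj x u ∧ Dominates G b c u ∧ c u = i ∧ G.Adj u w}
    with hM₁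
  set M₂ : Set V := {y | G.Adj x y ∧ c y = i} with hM₂
  set m₂ : V → ℕ := fun y => if Dominates G b c y then l else m y with hm₂
  set c₁ : V → ℕ := fun v => if v ∈ M₁ then m v else c v with hc₁
  set c₂ : V → ℕ := fun v => if v ∈ M₂ then m₂ v else c₁ v with hc₂
  set c' : V → ℕ := fun v => if v ∈ ({x} : Set V) then i else c₂ v with hc'
  have hM₁nd : ∀ w ∈ M₁, ¬ Dominates G b c w := by
    rintro w ⟨hwl, u, hxu, -, hui, huw⟩ hd
    obtain ⟨y, hxy, hyS, hwy⟩ := hblock w hd (hwl ▸ hlS)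
    have hxw : x ≠ w := by rintro rfl; simp at hl; omega
    have := hG.common_unique hxu hxy huw.symm hwy hxw
    exact hiS (by rw [← hui, this]; exact hyS)
  have hmM₁ : ∀ v ∈ M₁, m v ∈ Finset.Icc 1 b ∧ m v ≠ l ∧ ∀ w, G.Adj v w → c w ≠ m v :=
    fun v hv => by
      have hvl : c v = l := hv.1
      exact hvl ▸ hm v (hvl ▸ hl) (hM₁nd v hv)
  have h₁ : IsPartialColoring G b c₁ := by
    refine hc.recolor M₁ m (fun v hv w hw h => ?_) fun v hv => ⟨(hmM₁ v hv).1, (hmM₁ v hv).2.2⟩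
    simp only [Finset.mem_Icc] at hl
    exact hc.proper h (by have := hv.1; omega) (hv.1.trans hw.1.symm)
  -- vertices of `M₁` are adjacent to only one neighbor of `x`
  have honly : ∀ w ∈ M₁, ∀ y, G.Adj x y → G.Adj y w → Dominates G b c y ∧ c y = i := by
    rintro w ⟨hwl, u, hxu, hud, hui, huw⟩ y hxy hyw
    have hxw : x ≠ w := by rintro rfl; simp at hl; omega
    have := hG.common_unique hxu hxy huw.symm hyw.symm hxw
    exact this ▸ ⟨hud, hui⟩
  have hmM₂ : ∀ v ∈ M₂, m₂ v ∈ Finset.Icc 1 b ∧ m₂ v ≠ i ∧ ∀ w, G.Adj v w → c₁ w ≠ m₂ v := by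
    intro v hv
    by_cases hd : Dominates G b c v
    · simp only [hm₂, if_pos hd]
      refine ⟨hl, hil.symm, fun w hw => ?_⟩
      by_cases hwM : w ∈ M₁
      · simpa only [hc₁, if_pos hwM] using (hmM₁ w hwM).2.1
      · simp only [hc₁, if_neg hwM]
        exact fun h => hwM ⟨h, v, hv.1, hd, hv.2, hw⟩
    · simp only [hm₂, if_neg hd]
      have := hm v (hv.2 ▸ hi) hd
      refine ⟨this.1, hv.2 ▸ this.2.1, fun w hw => ?_⟩
      by_cases hwM : w ∈ M₁
      · exact absurd (honly w hwM v hv.1 hw).1 hd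
      · simpa only [hc₁, if_neg hwM] using this.2.2 w hw
  have hM₂ind : ∀ v ∈ M₂, ∀ w, G.Adj x w → ¬ G.Adj v w :=
    fun v hv w hw h => hG.no_triangle hv.1 h hw.symm
  have h₂ : IsPartialColoring G b c₂ :=
    h₁.recolor M₂ m₂ (fun v hv w hw => hM₂ind v hv w hw.1)
      fun v hv => ⟨(hmM₂ v hv).1, (hmM₂ v hv).2.2⟩
  have hM₁x : ∀ w ∈ M₁, ¬ G.Adj x w := fun w hw h => by
    obtain ⟨-, u, hxu, -, -, huw⟩ := hw
    exact hG.no_triangle hxu huw h.symm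
  have hp : IsPartialColoring G b c' := h₂.recolor {x} (fun _ => i) (by simp) (by
    simp only [Set.mem_singleton_iff, forall_eq]
    refine ⟨hi, fun w hw => ?_⟩
    by_cases hwM : w ∈ M₂
    · simpa only [hc₂, if_pos hwM] using (hmM₂ w hwM).2.1
    · have := hM₁x w
      grind)
  have heq : ∀ v, c v ≠ 0 → v ∉ M₁ → v ∉ M₂ → c' v = c v := by grind
  have hxi : c' x = i := by simp [hc']
  simp only [Finset.mem_Icc] at hi hl hsee hS hmM₁ hmM₂
  have hdx : Dominates G b c' x := by
    refine ⟨by simpa [hxi] using hi, fun j hj hjx => ?_⟩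
    simp only [Finset.mem_Icc] at hj
    obtain ⟨y, hy, rfl⟩ := hsee j hj
    exact ⟨y, hy, heq y (by omega) (fun h => hM₁x y h hy) fun h => by have := h.2; omega⟩
  obtain ⟨u, hxu, hud, hui⟩ := hS i hi hiS
  have huM : u ∈ M₂ := ⟨hxu, hui⟩
  have hul : c' u = l := by
    have : u ≠ x := hxu.ne'
    simp [hc', hc₂, hm₂, hud, this, huM]
  have hdu : Dominates G b c' u := by
    refine ⟨by simpa [hul] using hl, fun j hj hju => ?_⟩
    obtain rfl | hji := eq_or_ne j i
    · exact ⟨x, hxu.symm, hxi⟩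
    · obtain ⟨w, hw, rfl⟩ := hud.2 j hj (hui ▸ hji)
      simp only [Finset.mem_Icc] at hj
      exact ⟨w, hw, heq w (by omega) (fun h => hju (hul ▸ h.1)) fun h => hM₂ind u huM w h.1 hw⟩
  refine ⟨c', ⟨hp, fun j hj => ?_, x, u, hxu, hdx, hdu⟩, by omega, fun v hv => ?_⟩
  · obtain rfl | hji := eq_or_ne j i
    · exact ⟨x, hdx, hxi⟩
    obtain rfl | hjl := eq_or_ne j l
    · exact ⟨u, hdu, hul⟩
    have hj' := hj
    simp only [Finset.mem_Icc] at hj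
    have key : ∀ z, Dominates G b c z → c z = j → (∀ w ∈ M₁, ¬ G.Adj z w) →
        (∀ w ∈ M₂, ¬ G.Adj z w) → ∃ v, Dominates G b c' v ∧ c' v = j := by
      intro z hz hzj hz₁ hz₂
      have : c' z = c z := heq z (by omega) (fun h => hjl (hzj ▸ h.1)) fun h => hji (hzj ▸ h.2)
      exact ⟨z, hz.congr this fun w hw h0 =>
        heq w h0 (fun h => hz₁ w h hw) fun h => hz₂ w h hw, this.trans hzj⟩
    by_cases hjS : j ∈ S
    · obtain ⟨z, hz, hzj⟩ := hc.rep j hj'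
      obtain ⟨y, hxy, hyS, hzy⟩ := hblock z hz (hzj ▸ hjS)
      refine key z hz hzj (fun w hw h => ?_) fun w hw h => ?_
      · obtain ⟨-, u', hxu', -, -, hu'w⟩ := hw
        exact hG.no_pentagon hxy hzy.symm h hu'w.symm hxu'.symm
      · have hxz : x ≠ z := by rintro rfl; omega
        have := hG.common_unique hxy hw.1 hzy h hxz
        exact hiS (by rw [← hw.2, ← this]; exact hyS)
    · obtain ⟨z, hxz, hz, hzj⟩ := hS j hj hjS
      exact key z hz hzj (fun w hw h => hji (hzj ▸ (honly w hw z hxz h).2))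
        fun w hw h => hM₂ind w hw z hxz h.symm
  · have h1 := hmM₁ v
    have h2 := hmM₂ v
    grind

/-- Linked b-colorings extend to any further vertex. -/
theorem IsLinkedBColoring.extend (hG : NoShortCycle G) (hc : IsLinkedBColoring G b c)
    {x : V} (hx : c x = 0) :
    ∃ b' ≥ b, ∃ c', IsLinkedBColoring G b' c' ∧ c' x ≠ 0 ∧ ∀ v, c v ≠ 0 → c' v ≠ 0 := by
  classical
  by_cases hsee : ∀ i ∈ Finset.Icc 1 b, ∃ y, G.Adj x y ∧ c y = i
  swap
  · push Not at hsee
    obtain ⟨i, hi, hxi⟩ := hsee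
    exact ⟨b, le_rfl, hc.extend_missing hx hi hxi⟩
  set S : Finset ℕ := (Finset.Icc 1 b).filter
    fun i => ∀ y, G.Adj x y → c y = i → ¬ Dominates G b c y with hSdef
  have hS : ∀ j ∈ Finset.Icc 1 b, j ∉ S → ∃ y, G.Adj x y ∧ Dominates G b c y ∧ c y = j := by
    intro j hj hjS
    simp only [hSdef, Finset.mem_filter, hj, true_and] at hjS
    push Not at hjS
    obtain ⟨y, h1, h2, h3⟩ := hjS
    exact ⟨y, h1, h3, h2⟩
  obtain hSe | ⟨l, hlS⟩ := S.eq_empty_or_nonempty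
  · exact ⟨b + 1, b.le_succ, hc.extend_new_color hx fun i hi => hS i hi (by simp [hSe])⟩
  refine ⟨b, le_rfl, ?_⟩
  by_contra hcon
  have hSsub : S ⊆ Finset.Icc 1 b := Finset.filter_subset _ _
  have hblock : ∀ r : ℕ → V, (∀ j ∈ Finset.Icc 1 b, Dominates G b c (r j) ∧ c (r j) = j) →
      (∀ j ∈ Finset.Icc 1 b, j ∉ S → G.Adj x (r j)) →
      ((∃ d ∈ Finset.Icc 1 b, G.Adj x (r d)) ∨
        ∃ d ∈ Finset.Icc 1 b, ∃ e ∈ Finset.Icc 1 b, G.Adj (r d) (r e)) →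
      ∀ j ∈ S, ∃ y, G.Adj x y ∧ c y ∈ S ∧ G.Adj (r j) y := by
    intro r hr hrS hlink
    refine forall_blocked hG (fun j hj h => ?_) fun i hi => ?_
    · have := (hr j (hSsub hj)).2
      have := Finset.mem_Icc.1 (hSsub hj)
      rw [h] at *
      omega
    · by_contra! hno
      refine hcon (hc.extend_unblocked hG hx hsee (hSsub hi) (Finset.mem_filter.1 hi).2 hr ?_ hlink)
      intro j hj y hxy hyi hry
      by_cases hjS : j ∈ S
      · exact hno j hjS y hxy hyi hry
      · exact hG.no_triangle hxy hry.symm (hrS j hj hjS).symm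
  have hrep : ∀ j, ∃ v, j ∈ Finset.Icc 1 b →
      (Dominates G b c v ∧ c v = j) ∧ (j ∉ S → G.Adj x v) := by
    intro j
    by_cases hj : j ∈ Finset.Icc 1 b
    · by_cases hjS : j ∈ S
      · obtain ⟨v, hv⟩ := hc.rep j hj
        exact ⟨v, fun _ => ⟨hv, fun h => absurd hjS h⟩⟩
      · obtain ⟨v, h1, h2, h3⟩ := hS j hj hjS
        exact ⟨v, fun _ => ⟨⟨h2, h3⟩, fun _ => h1⟩⟩
    · exact ⟨x, fun h => absurd h hj⟩
  choose r hr using hrep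
  by_cases hSall : ∀ i ∈ Finset.Icc 1 b, i ∈ S
  · obtain ⟨p, q, hpq, hp, hq⟩ := hc.link
    have hne : c p ≠ c q := hc.proper hpq (by have := hp.1; simp at this; omega)
    set r' := Function.update (Function.update r (c p) p) (c q) q with hr'
    have hrp : r' (c p) = p := by simp [hr', hne]
    have hrq : r' (c q) = q := by simp [hr']
    have := hblock r' (fun j hj => by
        have := hr j hj
        grind [Function.update_apply]) (fun j hj h => absurd (hSall j hj) h)
      (Or.inr ⟨c p, hp.1, c q, hq.1, by rwa [hrp, hrq]⟩)
    obtain ⟨y, hxy, -, hy⟩ := this _ (hSall _ hp.1)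
    obtain ⟨y', hxy', -, hy'⟩ := this _ (hSall _ hq.1)
    rw [hrp] at hy
    rw [hrq] at hy'
    exact hG.no_pentagon hxy hy.symm hpq hy' hxy'.symm
  · push Not at hSall
    obtain ⟨i, hi, hiS⟩ := hSall
    refine hcon (hc.extend_trade hG hx hsee hS (fun z hz hzS => ?_) hi (hSsub hlS) hiS hlS)
    set r' := Function.update r (c z) z with hr'
    have := hblock r' (fun j hj => by
        have := hr j hj
        grind [Function.update_apply]) (fun j hj h => by
        have := hr j hj
        grind [Function.update_apply])
      (Or.inl ⟨i, hi, by
        have := hr i hi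
        grind [Function.update_apply]⟩) (c z) hzS
    simpa [hr'] using this

end Recolor

/-- Linked b-colorings extend to the whole graph. -/
theorem IsLinkedBColoring.exists_total {V : Type*} [Fintype V] {G : SimpleGraph V}
    (hG : NoShortCycle G) {b : ℕ} {c : V → ℕ} (hc : IsLinkedBColoring G b c) :
    ∃ b' ≥ b, ∃ c', IsLinkedBColoring G b' c' ∧ ∀ v, c' v ≠ 0 := by
  classical
  induction hn : (Finset.univ.filter fun v => c v = 0).card using Nat.strong_induction_on
    generalizing b c with
  | _ n ih =>
    by_cases h : ∀ v, c v ≠ 0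
    · exact ⟨b, le_rfl, c, hc, h⟩
    push Not at h
    obtain ⟨x, hx⟩ := h
    obtain ⟨b₁, hb₁, c₁, hc₁, hx₁, hsub⟩ := hc.extend hG hx
    have hlt : (Finset.univ.filter fun v => c₁ v = 0).card < n := by
      rw [← hn]
      refine Finset.card_lt_card ⟨fun v hv => ?_, fun hle => ?_⟩
      · simp only [Finset.mem_filter, Finset.mem_univ, true_and] at hv ⊢
        exact not_imp_not.1 (hsub v) hv
      · exact hx₁ (by simpa using hle (by simpa using hx : x ∈ _))
    obtain ⟨b₂, hb₂, c₂, h₂⟩ := ih _ hlt hc₁ rfl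
    exact ⟨b₂, hb₁.trans hb₂, c₂, h₂⟩

theorem card_le_of_all_used {V : Type*} [Fintype V] {k : ℕ} {c : V → ℕ}
    (h : ∀ i ∈ Finset.Icc 1 k, ∃ v, c v = i) : k ≤ Fintype.card V := by
  classical
  have : Finset.Icc 1 k ⊆ Finset.univ.image c := fun i hi => by simpa using h i hi
  simpa using (Finset.card_le_card this).trans Finset.card_image_le

theorem IsLinkedBColoring.le_bChromatic {V : Type*} [Fintype V] {G : SimpleGraph V}
    (hG : NoShortCycle G) {b : ℕ} {c : V → ℕ} (hc : IsLinkedBColoring G b c) :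
    b ≤ bChromatic G := by
  obtain ⟨b', hb, c', hc', h0⟩ := hc.exists_total hG
  refine hb.trans (le_csSup ⟨Fintype.card V, ?_⟩ ⟨c', ?_, fun v w h => hc'.proper h (h0 v), ?_⟩)
  · rintro k ⟨c, -, -, h⟩
    exact card_le_of_all_used fun i hi => (h i hi).imp fun _ => And.left
  · intro v
    have := hc'.le v
    have := h0 v
    simp only [Finset.mem_Icc]
    omega
  · intro i hi
    obtain ⟨v, hv, rfl⟩ := hc'.rep i hi
    exact ⟨v, rfl, hv.2⟩

/-- A functional relation between vertices and colors gives a partial coloring. -/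
theorem exists_partialColoring {V : Type*} {G : SimpleGraph V} {b : ℕ} (K : V → ℕ → Prop)
    (hK : ∀ y j, K y j → j ∈ Finset.Icc 1 b) (huniq : ∀ y i j, K y i → K y j → i = j)
    (hproper : ∀ y z j, G.Adj y z → K y j → ¬ K z j) :
    ∃ c, IsPartialColoring G b c ∧ ∀ y j, K y j → c y = j := by
  classical
  have hc : ∀ y j, K y j → (if h : ∃ j, K y j then h.choose else 0) = j := by
    intro y j hj
    have h : ∃ j, K y j := ⟨j, hj⟩
    rw [dif_pos h]
    exact huniq y _ _ h.choose_spec hj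
  refine ⟨_, ⟨fun v => ?_, fun {v w} hvw h0 heq => ?_⟩, hc⟩
  · split_ifs with h
    · exact (Finset.mem_Icc.1 (hK v _ h.choose_spec)).2
    · exact b.zero_le
  · by_cases hv : ∃ j, K v j
    · obtain ⟨j, hj⟩ := hv
      by_cases hw : ∃ j, K w j
      · obtain ⟨i, hi⟩ := hw
        rw [hc v j hj, hc w i hi] at heq
        exact hproper v w j hvw hj (heq ▸ hi)
      · rw [dif_neg hw] at heq
        exact h0 heq
    · exact h0 (dif_neg hv)

/-- `R 1` and `R 2` are the adjacent centers of a double star with vertices `R 1, …, R t`, of which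
`R 3, …, R (p + 2)` are leaves at `R 1` and the remaining ones are leaves at `R 2`; the vertices have
colors at least `t - 1`. -/
structure IsDoubleStar {V : Type*} (G : SimpleGraph V) (g : V → ℕ) (k p t : ℕ) (R : ℕ → V) :
    Prop where
  centers : G.Adj (R 1) (R 2)
  color_one : g (R 1) = k
  color_two : g (R 2) = k - 1
  left : ∀ a, 3 ≤ a → a ≤ p + 2 → G.Adj (R 1) (R a) ∧ g (R a) = t + a - 4
  right : ∀ a, p + 3 ≤ a → a ≤ t → G.Adj (R 2) (R a) ∧ g (R a) = t + a - p - 4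

namespace IsDoubleStar

variable {V : Type*} {G : SimpleGraph V} {g : V → ℕ} {k p t : ℕ} {R : ℕ → V}

theorem cases {p t a : ℕ} (ha : a ∈ Finset.Icc 1 t) :
    a = 1 ∨ a = 2 ∨ (3 ≤ a ∧ a ≤ p + 2) ∨ (p + 3 ≤ a ∧ a ≤ t) := by
  simp only [Finset.mem_Icc] at ha
  omega

theorem le_color (hR : IsDoubleStar G g k p t R) (htk : t ≤ k) {a : ℕ}
    (ha : a ∈ Finset.Icc 1 t) : t - 1 ≤ g (R a) := by
  have := hR.color_one
  have := hR.color_two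
  obtain rfl | rfl | ⟨h3, h4⟩ | ⟨h3, h4⟩ := cases (p := p) ha
  · omega
  · omega
  · have := (hR.left a h3 h4).2; omega
  · have := (hR.right a h3 h4).2; omega

theorem injective (hR : IsDoubleStar G g k p t R) (hG : NoShortCycle G) (ht : 2 ≤ t)
    (hp : p + t ≤ k) (hq : t ≤ p + 2 + (k - t)) (htk : t ≤ k) {a b : ℕ}
    (ha : a ∈ Finset.Icc 1 t) (hb : b ∈ Finset.Icc 1 t) (h : R a = R b) : a = b := by
  have hlr : ∀ a b, 3 ≤ a → a ≤ p + 2 → p + 3 ≤ b → b ≤ t → R a ≠ R b := by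
    intro a b h1 h2 h3 h4 h
    exact hG.no_triangle (hR.left a h1 h2).1 (h ▸ (hR.right b h3 h4).1.symm) hR.centers.symm
  have hgab : g (R a) = g (R b) := by rw [h]
  have hc1 := hR.color_one
  have hc2 := hR.color_two
  have hl := fun a h h' => (hR.left a h h').2
  have hr := fun a h h' => (hR.right a h h').2
  obtain rfl | rfl | ⟨h3, h4⟩ | ⟨h3, h4⟩ := cases (p := p) ha <;>
  obtain rfl | rfl | ⟨h5, h6⟩ | ⟨h5, h6⟩ := cases (p := p) hb <;>
  first
  | rfl
  | exact absurd h (hlr _ _ h3 h4 h5 h6)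
  | exact absurd h.symm (hlr _ _ h5 h6 h3 h4)
  | omega
  | (have := hl _ h3 h4; omega)
  | (have := hl _ h5 h6; omega)
  | (have := hr _ h3 h4; omega)
  | (have := hr _ h5 h6; omega)
  | (have := hl _ h3 h4; have := hl _ h5 h6; omega)
  | (have := hr _ h3 h4; have := hr _ h5 h6; omega)

theorem distance_le_three (hR : IsDoubleStar G g k p t R) (ht : 2 ≤ t) {a b : ℕ}
    (ha : a ∈ Finset.Icc 1 t) (hb : b ∈ Finset.Icc 1 t) (hab : a ≠ b) :
    G.Adj (R a) (R b) ∨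
      (∃ m ∈ Finset.Icc 1 t, G.Adj (R a) (R m) ∧ G.Adj (R m) (R b)) ∨
      ((3 ≤ a ∧ a ≤ p + 2) ∧ (p + 3 ≤ b ∧ b ≤ t)) ∨
      ((p + 3 ≤ a ∧ a ≤ t) ∧ (3 ≤ b ∧ b ≤ p + 2)) := by
  have h1 : 1 ∈ Finset.Icc 1 t := by simp only [Finset.mem_Icc]; omega
  have h2 : 2 ∈ Finset.Icc 1 t := by simp only [Finset.mem_Icc]; omega
  have h12 := hR.centers
  have hl := fun a h h' => (hR.left a h h').1
  have hr := fun a h h' => (hR.right a h h').1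
  obtain rfl | rfl | ⟨h3, h4⟩ | ⟨h3, h4⟩ := cases (p := p) ha <;>
  obtain rfl | rfl | ⟨h5, h6⟩ | ⟨h5, h6⟩ := cases (p := p) hb
  · exact absurd rfl hab
  · exact Or.inl h12
  · exact Or.inl (hl _ h5 h6)
  · exact Or.inr (Or.inl ⟨2, h2, h12, hr _ h5 h6⟩)
  · exact Or.inl h12.symm
  · exact absurd rfl hab
  · exact Or.inr (Or.inl ⟨1, h1, h12.symm, hl _ h5 h6⟩)
  · exact Or.inl (hr _ h5 h6)
  · exact Or.inl (hl _ h3 h4).symm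
  · exact Or.inr (Or.inl ⟨1, h1, (hl _ h3 h4).symm, h12⟩)
  · exact Or.inr (Or.inl ⟨1, h1, (hl _ h3 h4).symm, hl _ h5 h6⟩)
  · exact Or.inr (Or.inr (Or.inl ⟨⟨h3, h4⟩, h5, h6⟩))
  · exact Or.inr (Or.inl ⟨2, h2, (hr _ h3 h4).symm, h12.symm⟩)
  · exact Or.inl (hr _ h3 h4).symm
  · exact Or.inr (Or.inr (Or.inr ⟨⟨h3, h4⟩, h5, h6⟩))
  · exact Or.inr (Or.inl ⟨2, h2, (hr _ h3 h4).symm, hr _ h5 h6⟩)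

end IsDoubleStar

/-- The Grundy coloring of a graph without short cycles contains a double star whose vertices can
be made the representatives of a b-coloring of part of the graph. -/
theorem exists_linkedBColoring_of_grundy {V : Type*} {G : SimpleGraph V} (hG : NoShortCycle G)
    {k t : ℕ} {g : V → ℕ} (hg : IsGrundyColoring G k g) (ht : 2 ≤ t) (htk : 3 * t ≤ 2 * k + 2) :
    ∃ c, IsLinkedBColoring G t c := by
  classical
  obtain ⟨-, -, hused, hnb⟩ := hg
  obtain ⟨v, hv⟩ := hused k (by simp only [Finset.mem_Icc]; omega)
  have : Nonempty V := ⟨v⟩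
  choose! nb hnb using hnb
  obtain ⟨p, q, hpq, hqp, hpk, hqk, h2p⟩ : ∃ p q : ℕ, p + q + 2 = t ∧ p ≤ q ∧
      p + t ≤ k ∧ q + t ≤ k ∧ 2 * p ≤ t - 2 :=
    ⟨(t - 2) / 2, t - 2 - (t - 2) / 2, by omega, by omega, by omega, by omega, by omega⟩
  -- the double star, with the colors of its vertices
  obtain ⟨R, hR⟩ : ∃ R : ℕ → V, IsDoubleStar G g k p t R := by
    have hu := hnb v (k - 1) (by omega) (by omega)
    refine ⟨fun a => if a = 1 then v else if a = 2 then nb v (k - 1) else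
      if a ≤ p + 2 then nb v (t + a - 4) else nb (nb v (k - 1)) (t + a - p - 4),
      by simpa using hu.1, by simpa using hv, by simpa using hu.2, ?_, ?_⟩
    · intro a h3 hap
      have := hnb v (t + a - 4) (by omega) (by omega)
      simpa [show a ≠ 1 by omega, show a ≠ 2 by omega, hap] using this
    · intro a hap hat
      have := hnb (nb v (k - 1)) (t + a - p - 4) (by omega) (by omega)
      simpa [show a ≠ 1 by omega, show a ≠ 2 by omega, show ¬ a ≤ p + 2 by omega] using this
  have hR12 := hR.centers
  have hP := hR.left
  have hQ := hR.right
  have hcases : ∀ a ∈ Finset.Icc 1 t,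
      a = 1 ∨ a = 2 ∨ (3 ≤ a ∧ a ≤ p + 2) ∨ (p + 3 ≤ a ∧ a ≤ t) :=
    fun a ha => IsDoubleStar.cases ha
  have hlow := fun a => hR.le_color (by omega) (a := a)
  have hRinj := fun a ha b hb => hR.injective hG ht hpk (by omega) (by omega) (a := a) (b := b) ha hb
  have hdist := fun a ha b hb => hR.distance_le_three ht (a := a) (b := b) ha hb
  -- a vertex of small color has at most one neighbor in the double star
  have hone : ∀ y, g y ≤ t - 2 → ∀ a ∈ Finset.Icc 1 t, ∀ b ∈ Finset.Icc 1 t,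
      G.Adj (R a) y → G.Adj (R b) y → a = b := by
    intro y hy a ha b hb hay hby
    by_contra hab
    obtain h | ⟨m, hm, h, h'⟩ | ⟨⟨h3, h4⟩, h5, h6⟩ | ⟨⟨h3, h4⟩, h5, h6⟩ := hdist a ha b hb hab
    · exact hG.no_triangle h hby hay.symm
    · have := hG.common_unique h hay h'.symm hby fun h => hab (hRinj a ha b hb h)
      have hm' := hlow m hm
      rw [this] at hm'
      omega
    · exact hG.no_pentagon hay.symm (hP a h3 h4).1.symm hR12 (hQ b h5 h6).1 hby
    · exact hG.no_pentagon hby.symm (hP b h5 h6).1.symm hR12 (hQ a h3 h4).1 hay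
  set need : ℕ → Finset ℕ := fun a =>
    (Finset.Icc 1 t).filter fun j => j ≠ a ∧ ¬ G.Adj (R a) (R j) with hneed
  set W : ℕ → Finset V := fun a => (Finset.Icc 1 (t - 2)).image (nb (R a)) with hW
  have hnbR : ∀ a ∈ Finset.Icc 1 t, ∀ i ∈ Finset.Icc 1 (t - 2),
      G.Adj (R a) (nb (R a) i) ∧ g (nb (R a) i) = i := by
    intro a ha i hi
    have := hlow a ha
    simp only [Finset.mem_Icc] at hi
    exact hnb _ i (by omega) (by omega)
  have hWmem : ∀ a ∈ Finset.Icc 1 t, ∀ y ∈ W a, G.Adj (R a) y ∧ g y ≤ t - 2 := by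
    intro a ha y hy
    obtain ⟨i, hi, rfl⟩ := Finset.mem_image.1 hy
    have := hnbR a ha i hi
    exact ⟨this.1, this.2.trans_le (Finset.mem_Icc.1 hi).2⟩
  have hWcard : ∀ a ∈ Finset.Icc 1 t, (W a).card = t - 2 := by
    intro a ha
    rw [hW, Finset.card_image_of_injOn, Nat.card_Icc, Nat.add_sub_cancel]
    intro i hi j hj hij
    rw [← (hnbR a ha i hi).2, ← (hnbR a ha j hj).2, hij]
  have hneedcard : ∀ a ∈ Finset.Icc 1 t, (need a).card ≤ t - 2 := by
    intro a ha
    obtain ⟨e, he, hea, hadj⟩ : ∃ e ∈ Finset.Icc 1 t, e ≠ a ∧ G.Adj (R a) (R e) := by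
      simp only [Finset.mem_Icc]
      obtain rfl | rfl | ⟨h3, h4⟩ | ⟨h3, h4⟩ := hcases a ha
      · exact ⟨2, by omega, by omega, hR12⟩
      · exact ⟨1, by omega, by omega, hR12.symm⟩
      · exact ⟨1, by omega, by omega, (hP a h3 h4).1.symm⟩
      · exact ⟨2, by omega, by omega, (hQ a h3 h4).1.symm⟩
    have hsub : need a ⊆ ((Finset.Icc 1 t).erase a).erase e := by
      intro j hj
      simp only [hneed, Finset.mem_filter] at hj
      simp only [Finset.mem_erase]
      exact ⟨fun h => hj.2.2 (h ▸ hadj), hj.2.1, hj.1⟩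
    have := Finset.card_le_card hsub
    rw [Finset.card_erase_of_mem (by simp [he, hea]), Finset.card_erase_of_mem ha,
      Nat.card_Icc] at this
    omega
  -- colors for the further neighbors of the star vertices, on one side and then on the other
  have hE₀ : ∀ a, ∃ f : ℕ → V, a ∈ Finset.Icc 1 t →
      Set.InjOn f (need a) ∧ ∀ j ∈ need a, f j ∈ W a := by
    intro a
    by_cases ha : a ∈ Finset.Icc 1 t
    · obtain ⟨f, hf, hfW⟩ := exists_injOn_avoiding (need a) (W a) (fun _ _ => False) 0
        ((hneedcard a ha).trans (hWcard a ha).ge) (by omega) (by simp) (by simp)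
      exact ⟨f, fun _ => ⟨hf, fun j hj => (hfW j hj).1⟩⟩
    · exact ⟨fun _ => v, fun h => absurd h ha⟩
  choose E₀ hE₀ using hE₀
  have hE₁ : ∀ a, ∃ f : ℕ → V, p + 3 ≤ a → a ≤ t →
      Set.InjOn f (need a) ∧ ∀ j ∈ need a, f j ∈ W a ∧
        ¬ ∃ a' ∈ Finset.Icc 3 (p + 2), j ∈ need a' ∧ G.Adj (E₀ a' j) (f j) := by
    intro a
    by_cases haQ : p + 3 ≤ a ∧ a ≤ t
    swap
    · exact ⟨fun _ => v, fun h h' => absurd ⟨h, h'⟩ haQ⟩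
    have ha : a ∈ Finset.Icc 1 t := by simp only [Finset.mem_Icc]; omega
    have hPsub : ∀ a' ∈ Finset.Icc 3 (p + 2), a' ∈ Finset.Icc 1 t := by
      simp only [Finset.mem_Icc]
      omega
    have hPcard : (Finset.Icc 3 (p + 2)).card = p := by simp
    obtain ⟨B, hB⟩ : ∃ B : ℕ → V → Prop, ∀ j y, B j y ↔
        ∃ a' ∈ Finset.Icc 3 (p + 2), j ∈ need a' ∧ G.Adj (E₀ a' j) y := ⟨_, fun _ _ => Iff.rfl⟩
    have hmain := exists_injOn_avoiding (need a) (W a) B p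
      ((hneedcard a ha).trans (hWcard a ha).ge) (by rw [hWcard a ha]; omega)
    obtain ⟨f, hf⟩ := hmain (by
      intro j hj
      refine le_trans ?_ hPcard.le
      have hex : ∀ y ∈ (W a).filter (B j), ∃ a' ∈ Finset.Icc 3 (p + 2),
          j ∈ need a' ∧ G.Adj (E₀ a' j) y :=
        fun y hy => (hB j y).1 (Finset.mem_filter.1 hy).2
      choose! s hs using hex
      refine Finset.card_le_card_of_injOn s (fun y hy => (hs y hy).1) fun y hy z hz hyz => ?_
      obtain ⟨h1, h2, h3⟩ := hs y hy
      obtain ⟨-, -, h4⟩ := hs z hz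
      rw [← hyz] at h4
      have hyW := hWmem a ha y (Finset.mem_filter.1 hy).1
      have hzW := hWmem a ha z (Finset.mem_filter.1 hz).1
      refine hG.common_unique hyW.1 hzW.1 h3 h4 fun h => ?_
      have h5 := hlow a ha
      have h6 := hWmem _ (hPsub _ h1) _ ((hE₀ _ (hPsub _ h1)).2 j h2)
      rw [h] at h5
      omega) (by
      intro y hy
      refine le_trans ?_ hPcard.le
      have hex : ∀ j ∈ (need a).filter (B · y), ∃ a' ∈ Finset.Icc 3 (p + 2),
          j ∈ need a' ∧ G.Adj (E₀ a' j) y :=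
        fun j hj => (hB j y).1 (Finset.mem_filter.1 hj).2
      choose! s hs using hex
      refine Finset.card_le_card_of_injOn s (fun j hj => (hs j hj).1) fun i hi j hj hij => ?_
      obtain ⟨h1, h2, h3⟩ := hs i hi
      obtain ⟨-, h4, h5⟩ := hs j hj
      rw [← hij] at h4 h5
      have hE := hE₀ _ (hPsub _ h1)
      have hyW := hWmem a ha y hy
      refine hE.1 h2 h4 (hG.common_unique (hWmem _ (hPsub _ h1) _ (hE.2 i h2)).1
        (hWmem _ (hPsub _ h1) _ (hE.2 j h4)).1 h3.symm h5.symm fun h => ?_)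
      have := hlow _ (hPsub _ h1)
      rw [h] at this
      omega)
    exact ⟨f, fun _ _ => ⟨hf.1, fun j hj => (hf.2 j hj).imp id (mt (hB j (f j)).2)⟩⟩
  choose E₁ hE₁ using hE₁
  obtain ⟨E, hE, hEcross⟩ : ∃ E : ℕ → ℕ → V,
      (∀ a ∈ Finset.Icc 1 t, Set.InjOn (E a) (need a) ∧ ∀ j ∈ need a, E a j ∈ W a) ∧
      ∀ a b j, 3 ≤ a → a ≤ p + 2 → p + 3 ≤ b → b ≤ t → j ∈ need a → j ∈ need b →
        ¬ G.Adj (E a j) (E b j) := by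
    refine ⟨fun a => if a ≤ p + 2 then E₀ a else E₁ a, fun a ha => ?_, ?_⟩
    · by_cases hap : a ≤ p + 2
      · simpa [hap] using hE₀ a ha
      · have := hE₁ a (by omega) (Finset.mem_Icc.1 ha).2
        simp only [hap, if_false]
        exact ⟨this.1, fun j hj => (this.2 j hj).1⟩
    · intro a b j h3 hap hbp hbt hja hjb h
      simp only [hap, show ¬ b ≤ p + 2 by omega, if_true, if_false] at h
      exact ((hE₁ b hbp hbt).2 j hjb).2 ⟨a, Finset.mem_Icc.2 ⟨h3, hap⟩, hja, h⟩
  have hEadj : ∀ a ∈ Finset.Icc 1 t, ∀ j ∈ need a, G.Adj (R a) (E a j) ∧ g (E a j) ≤ t - 2 :=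
    fun a ha j hj => hWmem a ha _ ((hE a ha).2 j hj)
  have hRE : ∀ i ∈ Finset.Icc 1 t, ∀ a ∈ Finset.Icc 1 t, ∀ j ∈ need a, R i ≠ E a j := by
    intro i hi a ha j hj h
    have h1 := hlow i hi
    have h2 := (hEadj a ha j hj).2
    rw [h] at h1
    omega
  obtain ⟨c, hc, hcK⟩ := exists_partialColoring (G := G) (b := t)
    (fun y j => j ∈ Finset.Icc 1 t ∧
      (R j = y ∨ ∃ a ∈ Finset.Icc 1 t, j ∈ need a ∧ E a j = y)) (fun y j h => h.1) (by
    rintro y i j ⟨hi, hi'⟩ ⟨hj, hj'⟩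
    obtain rfl | ⟨a, ha, hia, rfl⟩ := hi'
    · obtain h | ⟨a, ha, hja, h⟩ := hj'
      · exact (hRinj j hj i hi h).symm
      · exact absurd h.symm (hRE i hi a ha j hja)
    · obtain h | ⟨b, hb, hjb, h⟩ := hj'
      · exact absurd h (hRE j hj a ha i hia)
      · have h1 := hEadj a ha i hia
        have h2 := hEadj b hb j hjb
        rw [h] at h2
        obtain rfl := hone _ h1.2 a ha b hb h1.1 h2.1
        exact ((hE a ha).1 hjb hia h).symm) (by
    have hRE' : ∀ j ∈ Finset.Icc 1 t, ∀ a ∈ Finset.Icc 1 t, j ∈ need a →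
        ¬ G.Adj (R j) (E a j) := by
      intro j hj a ha hja h
      have h1 := hEadj a ha j hja
      exact (Finset.mem_filter.1 hja).2.1 (hone _ h1.2 j hj a ha h h1.1)
    rintro y z j hyz ⟨hj, hy⟩ ⟨-, hz⟩
    obtain rfl | ⟨a, ha, hja, rfl⟩ := hy
    · obtain rfl | ⟨a, ha, hja, rfl⟩ := hz
      · exact hyz.ne rfl
      · exact hRE' j hj a ha hja hyz
    · obtain rfl | ⟨b, hb, hjb, rfl⟩ := hz
      · exact hRE' j hj a ha hja hyz.symm
      · have hab : a ≠ b := by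
          rintro rfl
          exact hyz.ne rfl
        have h1 := (hEadj a ha j hja).1
        have h2 := (hEadj b hb j hjb).1
        obtain h | ⟨m, hm, h, h'⟩ | ⟨⟨h3, h4⟩, h5, h6⟩ | ⟨⟨h3, h4⟩, h5, h6⟩ :=
          hdist a ha b hb hab
        · exact hRE a ha b hb j hjb
            (hG.common_unique h1.symm hyz h.symm h2 (hRE b hb a ha j hja).symm)
        · exact hG.no_pentagon h1.symm h h' h2 hyz.symm
        · exact hEcross a b j h3 h4 h5 h6 hja hjb hyz
        · exact hEcross b a j h5 h6 h3 h4 hjb hja hyz.symm)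
  have hcR : ∀ j ∈ Finset.Icc 1 t, c (R j) = j := fun j hj => hcK _ _ ⟨hj, Or.inl rfl⟩
  have hdom : ∀ a ∈ Finset.Icc 1 t, Dominates G t c (R a) := by
    intro a ha
    refine ⟨by rwa [hcR a ha], fun j hj hja => ?_⟩
    rw [hcR a ha] at hja
    by_cases hadj : G.Adj (R a) (R j)
    · exact ⟨R j, hadj, hcR j hj⟩
    · have hjn : j ∈ need a := Finset.mem_filter.2 ⟨hj, hja, hadj⟩
      exact ⟨E a j, (hEadj a ha j hjn).1, hcK _ _ ⟨hj, Or.inr ⟨a, ha, hjn, rfl⟩⟩⟩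
  refine ⟨c, hc, fun j hj => ⟨R j, hdom j hj, hcR j hj⟩, R 1, R 2, hR12, hdom 1 ?_, hdom 2 ?_⟩ <;>
  · simp only [Finset.mem_Icc]
    omega

/-- a graph of girth at least 6 satisfies `⌊2Γ(G)/3⌋ ≤ b(G)`. -/
theorem girth_six_grundy_le {V : Type*} [Fintype V] (G : SimpleGraph V)
    (h : 6 ≤ G.girth) :
    2 * grundyNumber G / 3 ≤ bChromatic G := by
  have hG := NoShortCycle.of_girth h
  by_cases hk : grundyNumber G ≤ 1
  · omega
  have hbdd : BddAbove {k | ∃ c : V → ℕ, IsGrundyColoring G k c} :=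
    ⟨Fintype.card V, fun k ⟨c, hc⟩ => card_le_of_all_used hc.2.2.1⟩
  have hne : {k | ∃ c : V → ℕ, IsGrundyColoring G k c}.Nonempty := by
    by_contra hemp
    rw [Set.not_nonempty_iff_eq_empty] at hemp
    simp [grundyNumber, hemp] at hk
  obtain ⟨g, hg⟩ : ∃ g, IsGrundyColoring G (grundyNumber G) g := Nat.sSup_mem hne hbdd
  obtain ⟨c, hc⟩ := exists_linkedBColoring_of_grundy hG hg
    (t := (2 * grundyNumber G + 2) / 3) (by omega) (by omega)
  exact (Nat.div_le_div_right (by omega)).trans (hc.le_bChromatic hG)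
end
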